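/- arXiv:2601.05571 — 3 statements merged into one kernel-verified Lean document; each statement's English description precedes it below -/
import Mathlib

section
/- There exists a smooth cubic form F in ℂ[x₀,…,x₄] (homogeneous of degree 3) such that the orthogonal complement (J_{F,3})^⊥ of the degree-3 part of its Jacobian ideal with respect to the polar pairing contains a smooth cubic form. (Non-emptiness of the set 𝒰 from Theorem 1.3.) -/
open MvPolynomial

/-- `F` is smooth: the only common zero of its partial derivatives is the origin. -/
def SmoothForm {N : ℕ} (F : MvPolynomial (Fin N) ℂ) : Prop :=
  ∀ x : Fin N → ℂ, (∀ i, eval x (pderiv i F) = 0) → x = 0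

/-- The Jacobian ideal of `F`. -/
noncomputable def jacobianIdeal {N : ℕ} (F : MvPolynomial (Fin N) ℂ) : Ideal (MvPolynomial (Fin N) ℂ) :=
  Ideal.span (Set.range fun i => pderiv i F)

/-- `J_{F,k} = J_F ∩ S_k`. -/
def Jpart {N : ℕ} (F : MvPolynomial (Fin N) ℂ) (k : ℕ) : Set (MvPolynomial (Fin N) ℂ) :=
  {b | b ∈ jacobianIdeal F ∧ b ∈ homogeneousSubmodule (Fin N) ℂ k}

/-- The polar pairing `⟨P, G⟩ = G(∂/∂x₀,…)P`, as a constant (the constant coefficient of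
the result of applying the differential operator `G(∂)` to `P`). -/
noncomputable def polarPair {N : ℕ} (P G : MvPolynomial (Fin N) ℂ) : ℂ :=
  constantCoeff (∑ m ∈ G.support, G.coeff m •
    ((List.ofFn fun i : Fin N =>
      ((pderiv i).toLinearMap : Module.End ℂ (MvPolynomial (Fin N) ℂ)) ^ (m i)).prod P))

/-- `E^⊥ = {G ∈ S₃ : ⟨b, G⟩ = 0 for all b ∈ E}`. -/
def perp {N : ℕ} (E : Set (MvPolynomial (Fin N) ℂ)) : Set (MvPolynomial (Fin N) ℂ) :=
  {G | G ∈ homogeneousSubmodule (Fin N) ℂ 3 ∧ ∀ b ∈ E, polarPair b G = 0}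

noncomputable def exF : MvPolynomial (Fin 5) ℂ := 13 * ∑ i, X i ^ 3 - (∑ i, X i) ^ 3

noncomputable def exG : MvPolynomial (Fin 5) ℂ :=
  2 * (∑ i, X i ^ 3) - 3 * ∑ i, ∑ j, X i * X j ^ 2

lemma exF_hom : exF ∈ homogeneousSubmodule (Fin 5) ℂ 3 := by
  have h : exF = (13 : ℂ) • ∑ i, X i ^ 3 - (∑ i, X i) ^ 3 := by
    rw [smul_eq_C_mul, exF]; congr 1
  rw [h]
  refine Submodule.sub_mem _ (Submodule.smul_mem _ _ (Submodule.sum_mem _ fun i _ => ?_)) ?_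
  · exact isHomogeneous_X_pow i 3
  · have : (∑ i, X i : MvPolynomial (Fin 5) ℂ).IsHomogeneous 1 :=
      IsHomogeneous.sum _ _ _ fun i _ => isHomogeneous_X ℂ i
    simpa using this.pow 3

lemma exG_eq : exG = (2 : ℂ) • (∑ i, X i ^ 3) - (3 : ℂ) • ∑ i, ∑ j, X i * X j ^ 2 := by
  rw [smul_eq_C_mul, smul_eq_C_mul, exG]; congr 1

lemma exG_hom : exG ∈ homogeneousSubmodule (Fin 5) ℂ 3 := by
  rw [exG_eq]
  refine Submodule.sub_mem _ (Submodule.smul_mem _ _ (Submodule.sum_mem _ fun i _ => ?_))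
    (Submodule.smul_mem _ _ (Submodule.sum_mem _ fun i _ => Submodule.sum_mem _ fun j _ => ?_))
  · exact isHomogeneous_X_pow i 3
  · exact (isHomogeneous_X ℂ i).mul (isHomogeneous_X_pow j 2)

lemma pderiv_exF (i : Fin 5) : pderiv i exF = C 39 * X i ^ 2 - C 3 * (∑ j, X j) ^ 2 := by
  have h39 : (C 39 : MvPolynomial (Fin 5) ℂ) = 39 := map_ofNat _ _
  have h3 : (C 3 : MvPolynomial (Fin 5) ℂ) = 3 := map_ofNat _ _
  have h13 : (13 : MvPolynomial (Fin 5) ℂ) = C 13 := (map_ofNat _ _).symm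
  rw [exF, h13]
  simp only [map_sub, map_sum, pderiv_C_mul, pderiv_pow, pderiv_X, Pi.single_apply]
  simp [h39, h3, Finset.mul_sum, smul_eq_C_mul]
  have h13' : (C 13 : MvPolynomial (Fin 5) ℂ) = 13 := map_ofNat _ _
  rw [h13']; ring

lemma pderiv_exG (i : Fin 5) : pderiv i exG =
    C 6 * X i ^ 2 - C 3 * ∑ j, X j ^ 2 - C 6 * (∑ j, X j) * X i := by
  have h6 : (C 6 : MvPolynomial (Fin 5) ℂ) = 6 := map_ofNat _ _
  have h3 : (C 3 : MvPolynomial (Fin 5) ℂ) = 3 := map_ofNat _ _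
  have h2 : (C 2 : MvPolynomial (Fin 5) ℂ) = 2 := map_ofNat _ _
  rw [exG_eq]
  simp only [map_sub, map_sum, Derivation.map_smul, pderiv_mul, pderiv_pow, pderiv_X,
    Pi.single_apply]
  fin_cases i <;> simp [h6, h3, h2, Fin.sum_univ_five, smul_eq_C_mul] <;> ring

lemma exF_smooth : SmoothForm exF := by
  intro x hx
  simp only [pderiv_exF, map_sub, map_mul, map_pow, eval_C, eval_X, map_sum] at hx
  set p := ∑ j, x j with hp
  have hsq : ∀ i, 13 * x i ^ 2 = p ^ 2 := fun i => by linear_combination (hx i) / 3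
  have hc : ∀ i, x i = x 0 ∨ x i = - x 0 := fun i => by
    apply sq_eq_sq_iff_eq_or_eq_neg.mp
    linear_combination (hsq i - hsq 0) / 13
  have h0 : x 0 = 0 := by
    have e := hsq 0
    rw [hp, Fin.sum_univ_five] at e
    apply pow_eq_zero_iff (two_ne_zero) |>.mp
    rcases hc 1 with h1 | h1 <;> rcases hc 2 with h2 | h2 <;> rcases hc 3 with h3 | h3 <;>
      rcases hc 4 with h4 | h4 <;> rw [h1, h2, h3, h4] at e <;> ring_nf at e ⊢ <;> grind
  funext i
  rcases hc i with h | h <;> simp [h, h0]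

lemma exG_smooth : SmoothForm exG := by
  intro x hx
  simp only [pderiv_exG, map_sub, map_mul, map_pow, eval_C, eval_X, map_sum] at hx
  set p := ∑ j, x j with hp
  have hc : ∀ i, x i = x 0 ∨ x i = p - x 0 := fun i => by
    have : (x i - x 0) * (x i - (p - x 0)) = 0 := by
      linear_combination (hx i - hx 0) / 6
    rcases mul_eq_zero.mp this with h | h
    · left; linear_combination h
    · right; linear_combination h
  have e := hx 0
  rw [Fin.sum_univ_five] at e hp
  have key : x 0 ^ 2 = 0 ∧ p ^ 2 = 0 := by
    generalize x 0 = a at *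
    generalize p = p at *
    rcases hc 1 with h1 | h1 <;> rcases hc 2 with h2 | h2 <;> rcases hc 3 with h3 | h3 <;>
      rcases hc 4 with h4 | h4 <;> rw [h1, h2, h3, h4] at e hp <;> clear hc h1 h2 h3 h4 hx <;> grind
  have h0 : x 0 = 0 := by simpa using key.1
  have h1 : p = 0 := by simpa using key.2
  funext i
  rcases hc i with h | h <;> simp [h, h0, h1]

/-- The operator attached to an exponent. -/
noncomputable def opT (P : MvPolynomial (Fin 5) ℂ) (m : Fin 5 →₀ ℕ) : ℂ :=
  constantCoeff ((List.ofFn fun i : Fin 5 =>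
      ((pderiv i).toLinearMap : Module.End ℂ (MvPolynomial (Fin 5) ℂ)) ^ (m i)).prod P)

/-- The pairing as a linear map in the second argument. -/
noncomputable def pairL (P : MvPolynomial (Fin 5) ℂ) : MvPolynomial (Fin 5) ℂ →ₗ[ℂ] ℂ :=
  (basisMonomials (Fin 5) ℂ).constr ℂ (opT P)

lemma polarPair_eq (P G : MvPolynomial (Fin 5) ℂ) : polarPair P G = pairL P G := by
  conv_rhs => rw [G.as_sum]
  rw [polarPair, map_sum, map_sum]
  refine Finset.sum_congr rfl fun m _ => ?_
  have : monomial m (G.coeff m) = G.coeff m • basisMonomials (Fin 5) ℂ m := by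
    simp [smul_monomial]
  rw [this, LinearMap.map_smul, pairL, Module.Basis.constr_basis, opT]
  simp [smul_eq_C_mul]

lemma pairL_monomial (P : MvPolynomial (Fin 5) ℂ) (m : Fin 5 →₀ ℕ) :
    pairL P (monomial m 1) = opT P m := by
  have : monomial m (1 : ℂ) = basisMonomials (Fin 5) ℂ m := by simp
  rw [this, pairL, Module.Basis.constr_basis]

lemma pd_comm (i j : Fin 5) (P : MvPolynomial (Fin 5) ℂ) :
    pderiv i (pderiv j P) = pderiv j (pderiv i P) := by
  have h : ⁅(pderiv i : Derivation ℂ (MvPolynomial (Fin 5) ℂ) (MvPolynomial (Fin 5) ℂ)),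
      (pderiv j : Derivation ℂ (MvPolynomial (Fin 5) ℂ) (MvPolynomial (Fin 5) ℂ))⁆ = 0 := by
    apply MvPolynomial.derivation_ext
    intro k
    simp only [Derivation.commutator_apply, pderiv_X, Pi.single_apply]
    split_ifs <;> simp
  have := congrArg (fun D => D P) h
  simpa [Derivation.commutator_apply, sub_eq_zero] using this

lemma pairL_X3 (P : MvPolynomial (Fin 5) ℂ) (i : Fin 5) :
    pairL P (X i ^ 3) = constantCoeff (pderiv i (pderiv i (pderiv i P))) := by
  rw [X_pow_eq_monomial, pairL_monomial, opT]
  fin_cases i <;> simp [List.ofFn_succ, Finsupp.single_apply, pow_succ]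

lemma pairL_X12 (P : MvPolynomial (Fin 5) ℂ) (i j : Fin 5) :
    pairL P (X i * X j ^ 2) = constantCoeff (pderiv i (pderiv j (pderiv j P))) := by
  by_cases hij : i = j
  · subst hij
    rw [← pairL_X3]; congr 1; ring
  have : (X i * X j ^ 2 : MvPolynomial (Fin 5) ℂ) =
      monomial (Finsupp.single i 1 + Finsupp.single j 2) 1 := by
    rw [X_pow_eq_monomial, X, monomial_mul]; simp
  rw [this, pairL_monomial, opT]
  have h1 := pd_comm i j (pderiv j P)
  have h2 := pd_comm i j P
  fin_cases i <;> fin_cases j <;>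
    first
    | exact absurd rfl hij
    | (simp [List.ofFn_succ, Finsupp.single_apply, pow_succ]; done)
    | (simp at h1 h2; simp [List.ofFn_succ, Finsupp.single_apply, pow_succ, h1, h2])

lemma leib (a Q : MvPolynomial (Fin 5) ℂ) (h0 : constantCoeff Q = 0)
    (h1 : ∀ i, constantCoeff (pderiv i Q) = 0) (i j k : Fin 5) :
    constantCoeff (pderiv i (pderiv j (pderiv k (a * Q)))) =
      constantCoeff (pderiv i a) * constantCoeff (pderiv j (pderiv k Q)) +
      constantCoeff (pderiv j a) * constantCoeff (pderiv i (pderiv k Q)) +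
      constantCoeff (pderiv k a) * constantCoeff (pderiv i (pderiv j Q)) +
      constantCoeff a * constantCoeff (pderiv i (pderiv j (pderiv k Q))) := by
  simp only [pderiv_mul, map_add, map_mul, h0, h1]
  ring

lemma pd1 (l k : Fin 5) : pderiv k (pderiv l exF) =
    C (if l = k then 78 else 0) * X l - C 6 * ∑ j, X j := by
  have h6 : (C 6 : MvPolynomial (Fin 5) ℂ) = 6 := map_ofNat _ _
  have h3 : (C 3 : MvPolynomial (Fin 5) ℂ) = 3 := map_ofNat _ _
  have h39 : (C 39 : MvPolynomial (Fin 5) ℂ) = 39 := map_ofNat _ _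
  have h78 : (C 78 : MvPolynomial (Fin 5) ℂ) = 78 := map_ofNat _ _
  rw [pderiv_exF]
  simp only [map_sub, map_sum, pderiv_C_mul, pderiv_pow, pderiv_X, Pi.single_apply]
  by_cases h : k = l
  · simp [h, h6, h3, h39, h78, smul_eq_C_mul]; ring
  · simp [h, Ne.symm h, h6, h3, smul_eq_C_mul]; ring

lemma pd2 (l k j : Fin 5) : pderiv j (pderiv k (pderiv l exF)) =
    C ((if l = k ∧ l = j then 78 else 0) - 6) := by
  rw [pd1]
  simp only [map_sub, map_sum, pderiv_C_mul, pderiv_X, Pi.single_apply]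
  by_cases h : l = k <;> by_cases h' : l = j <;> simp [h, h', Ne.symm, smul_eq_C_mul, eq_comm]
  all_goals grind

lemma pair_zero (a : MvPolynomial (Fin 5) ℂ) (l : Fin 5) :
    pairL (a * pderiv l exF) exG = 0 := by
  have h0 : constantCoeff (pderiv l exF) = 0 := by simp [pderiv_exF]
  have h1 : ∀ i, constantCoeff (pderiv i (pderiv l exF)) = 0 := by simp [pd1]
  rw [exG_eq]
  simp only [map_sub, map_smul, map_sum, pairL_X3, pairL_X12, leib _ _ h0 h1, pd2,
    pderiv_C, constantCoeff_C, map_zero]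
  fin_cases l <;> simp [Fin.sum_univ_five] <;> ring

theorem nonempty_U : ∃ F : MvPolynomial (Fin 5) ℂ,
    F ∈ homogeneousSubmodule (Fin 5) ℂ 3 ∧ SmoothForm F ∧
      ∃ G, G ∈ perp (Jpart F 3) ∧ SmoothForm G := by
  refine ⟨exF, exF_hom, exF_smooth, exG, ⟨exG_hom, ?_⟩, exG_smooth⟩
  rintro b ⟨hb, -⟩
  rw [polarPair_eq]
  obtain ⟨c, rfl⟩ := (Ideal.mem_span_range_iff_exists_fun).mp hb
  have hadd : ∀ P Q : MvPolynomial (Fin 5) ℂ, pairL (P + Q) = pairL P + pairL Q := by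
    intro P Q
    apply (basisMonomials (Fin 5) ℂ).ext
    intro m
    simp [pairL_monomial, opT]
  simp [Fin.sum_univ_five, hadd, pair_zero]
end

section
/- The set 𝒰 of smooth cubic forms F in ℂ[x₀,…,x₄] such that (J_{F,3})^⊥ contains a smooth cubic is a Zariski open subset of the 35-dimensional vector space S_3 of cubic forms; that is, its complement S_3 ∖ 𝒰 is the common zero locus of a family of polynomial functions in the coefficients of F. -/
open MvPolynomial

/-- The set `𝒰` of smooth cubic forms `F` such that `(J_{F,3})^⊥` contains a smooth cubic. -/
def calU : Set (MvPolynomial (Fin 5) ℂ) :=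
  {F | F ∈ homogeneousSubmodule (Fin 5) ℂ 3 ∧ SmoothForm F ∧
    ∃ G, G ∈ perp (Jpart F 3) ∧ SmoothForm G}


lemma shift_aux (f : ℕ → ℕ → ℕ → ℂ) (k : ℕ) (hk : 1 ≤ k)
    (h : ∀ a b c, f (a+1) b c + f a (b+1) c + f a b (c+1) = 0)
    (h1 : ∀ a b c, k + 1 ≤ a → f a b c = 0)
    (h2 : ∀ a b c, k + 1 ≤ b → f a b c = 0)
    (h3 : ∀ a b c, k + 1 ≤ c → f a b c = 0) : f k k 0 = 0 := by
  let S1 : Module.End ℂ (ℕ → ℕ → ℕ → ℂ) :=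
    { toFun := fun g a b c => g (a+1) b c, map_add' := fun _ _ => rfl, map_smul' := fun _ _ => rfl }
  let S2 : Module.End ℂ (ℕ → ℕ → ℕ → ℂ) :=
    { toFun := fun g a b c => g a (b+1) c, map_add' := fun _ _ => rfl, map_smul' := fun _ _ => rfl }
  let S3 : Module.End ℂ (ℕ → ℕ → ℕ → ℂ) :=
    { toFun := fun g a b c => g a b (c+1), map_add' := fun _ _ => rfl, map_smul' := fun _ _ => rfl }
  have c12 : Commute S1 S2 := rfl
  have p1 : ∀ n g a b c, (S1 ^ n) g a b c = g (a+n) b c := by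
    intro n
    induction n with
    | zero => intros; rfl
    | succ n ih => intro g a b c; rw [pow_succ, Module.End.mul_apply, ih]; rfl
  have p2 : ∀ n g a b c, (S2 ^ n) g a b c = g a (b+n) c := by
    intro n
    induction n with
    | zero => intros; rfl
    | succ n ih => intro g a b c; rw [pow_succ, Module.End.mul_apply, ih]; rfl
  have p12 : ∀ n, ∃ e : ℂ, ∀ a b c, ((S1 + S2) ^ n) f a b c = e * f a b (c + n) := by
    intro n
    induction n with
    | zero => exact ⟨1, fun a b c => by simp⟩
    | succ n ih =>
      obtain ⟨e, he⟩ := ih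
      refine ⟨-e, fun a b c => ?_⟩
      rw [pow_succ', Module.End.mul_apply]
      change ((S1 + S2) ^ n) f (a+1) b c + ((S1 + S2) ^ n) f a (b+1) c = _
      rw [he, he]
      have := h a b (c+n)
      rw [← add_assoc c n 1]
      linear_combination e * this
  obtain ⟨e, he⟩ := p12 (k + k)
  have key := he 0 0 0
  rw [h3 0 0 _ (by omega), mul_zero, c12.add_pow] at key
  rw [LinearMap.sum_apply, Finset.sum_apply, Finset.sum_apply, Finset.sum_apply] at key
  rw [Finset.sum_eq_single k] at key
  · have e1 : ((k+k).choose k : Module.End ℂ (ℕ → ℕ → ℕ → ℂ)) f = ((k+k).choose k : ℂ) • f := by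
      ext a b c
      simp [Module.End.natCast_apply]
    rw [Module.End.mul_apply, e1, map_smul, Module.End.mul_apply] at key
    simp only [Pi.smul_apply, p1, p2, smul_eq_mul, Nat.add_sub_cancel, zero_add] at key
    rcases mul_eq_zero.1 key with h0 | h0
    · exfalso
      have := Nat.choose_pos (Nat.le_add_right k k)
      norm_cast at h0
      omega
    · exact h0
  · intro b hb hbk
    have e1 : ((k+k).choose b : Module.End ℂ (ℕ → ℕ → ℕ → ℂ)) f = ((k+k).choose b : ℂ) • f := by
      ext a b c
      simp [Module.End.natCast_apply]
    rw [Module.End.mul_apply, e1, map_smul, Module.End.mul_apply]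
    simp only [Pi.smul_apply, p1, p2, smul_eq_mul, zero_add]
    simp only [Finset.mem_range] at hb
    rcases lt_or_gt_of_ne hbk with h' | h'
    · rw [h2 _ _ _ (by omega), mul_zero]
    · rw [h1 _ _ _ (by omega), mul_zero]
  · intro hk'
    simp at hk'

lemma stab_zero {V : Type*} [AddCommGroup V] [Module ℂ V] [FiniteDimensional ℂ V]
    (T : V →ₗ[ℂ] V →ₗ[ℂ] V →ₗ[ℂ] ℂ) (A : Module.End ℂ V)
    (hA : ∀ x y z, T (A x) y z + T x (A y) z + T x y (A z) = 0)
    (hT : ∀ v, (∀ w, T v v w = 0) → v = 0) : A = 0 := by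
  -- all eigenvalues vanish
  have hev : ∀ μ, A.HasEigenvalue μ → μ = 0 := by
    intro μ hμ
    obtain ⟨l, hl, hmax⟩ := Set.exists_max_image {μ | A.HasEigenvalue μ} (fun z => ‖z‖)
      A.finite_hasEigenvalue ⟨μ, hμ⟩
    by_contra hne
    have hlpos : 0 < ‖l‖ := lt_of_lt_of_le (norm_pos_iff.2 hne) (hmax μ hμ)
    obtain ⟨v, hv⟩ := Module.End.HasEigenvalue.exists_hasEigenvector hl
    have hinj : Function.Injective (A - algebraMap ℂ (Module.End ℂ V) (-2 * l)) := by
      rw [← LinearMap.ker_eq_bot]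
      by_contra hk
      have : A.HasEigenvalue (-2 * l) := by
        rw [Module.End.hasEigenvalue_iff, Module.End.eigenspace_def]
        exact hk
      have h2 := hmax _ this
      simp at h2
      linarith
    have hsurj := LinearMap.surjective_of_injective hinj
    apply hv.2
    apply hT
    intro w
    obtain ⟨z, rfl⟩ := hsurj w
    have h3 := hA v v z
    rw [hv.apply_eq_smul] at h3
    simp at h3 ⊢
    linear_combination h3
  have hnil : IsNilpotent A := by
    have htop := Module.End.iSup_maxGenEigenspace_eq_top A
    have h0 : A.maxGenEigenspace 0 = ⊤ := by
      rw [eq_top_iff, ← htop]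
      refine iSup_le fun μ => ?_
      by_cases hμ : μ = 0
      · rw [hμ]
      · have : A.maxGenEigenspace μ = ⊥ := by
          by_contra hb
          apply hμ
          apply hev
          rw [Module.End.maxGenEigenspace_eq] at hb
          exact Module.End.hasEigenvalue_of_hasGenEigenvalue (k := A.maxGenEigenspaceIndex μ) hb
        rw [this]
        exact bot_le
    rw [Module.End.maxGenEigenspace_eq, Module.End.genEigenspace_zero_nat] at h0
    exact ⟨_, LinearMap.ker_eq_top.1 h0⟩
  by_contra hne
  obtain ⟨k, hk1, hk2⟩ : ∃ k, A ^ (k+1) = 0 ∧ A ^ k ≠ 0 := by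
    classical
    have hp := Nat.find_spec hnil
    have hm := fun n => @Nat.find_min _ _ hnil n
    generalize Nat.find hnil = N at hp hm
    cases N with
    | zero =>
      exfalso; apply hne
      rw [pow_zero] at hp
      rw [← mul_one A, hp, mul_zero]
    | succ n => exact ⟨n, hp, hm n (Nat.lt_succ_self n)⟩
  have hk : 1 ≤ k := by
    rcases Nat.eq_zero_or_pos k with h | h
    · subst h; simp at hk1; exact absurd hk1 hne
    · exact h
  have hz : ∀ a, k + 1 ≤ a → A ^ a = 0 := fun a ha => pow_eq_zero_of_le ha hk1
  apply hk2
  ext x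
  apply hT
  intro z
  have := shift_aux (fun a b c => T ((A ^ a) x) ((A ^ b) x) ((A ^ c) z)) k hk ?_ ?_ ?_ ?_
  · simpa using this
  · intro a b c
    have := hA ((A ^ a) x) ((A ^ b) x) ((A ^ c) z)
    simpa only [pow_succ', Module.End.mul_apply] using this
  · intro a b c h; simp [hz a h]
  · intro a b c h; simp [hz b h]
  · intro a b c h; simp [hz c h]

/-- Index set of monomials of degree `n`. -/
noncomputable instance fintypeDeg (n : ℕ) : Fintype {m : Fin 5 →₀ ℕ // m.degree = n} :=
  ((Finsupp.finite_of_degree_le (σ := Fin 5) n).subset (fun _ h => le_of_eq h)).fintype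

/-- Polynomial functions in the coefficients of `F`. -/
noncomputable def polyFun : Subalgebra ℂ (MvPolynomial (Fin 5) ℂ → ℂ) :=
  (aeval (R := ℂ) (fun (m : Fin 5 →₀ ℕ) (F : MvPolynomial (Fin 5) ℂ) => coeff m F)).range

lemma aeval_polyFun (P : MvPolynomial (Fin 5 →₀ ℕ) ℂ) (F : MvPolynomial (Fin 5) ℂ) :
    aeval (R := ℂ) (fun (m : Fin 5 →₀ ℕ) (F : MvPolynomial (Fin 5) ℂ) => coeff m F) P F
      = eval (fun m => coeff m F) P := by
  induction P using MvPolynomial.induction_on with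
  | C a => simp
  | add p q hp hq => simp [hp, hq]
  | mul_X p i hp => simp [hp]

lemma mem_polyFun {φ : MvPolynomial (Fin 5) ℂ → ℂ} :
    φ ∈ polyFun ↔ ∃ P, ∀ F, φ F = eval (fun m => coeff m F) P := by
  constructor
  · rintro ⟨P, rfl⟩
    exact ⟨P, fun F => aeval_polyFun P F⟩
  · rintro ⟨P, hP⟩
    exact ⟨P, funext fun F => by rw [hP]; exact aeval_polyFun P F⟩

lemma polyFun_const (c : ℂ) : (fun _ => c) ∈ polyFun := polyFun.algebraMap_mem c

lemma polyFun_mul {φ ψ : MvPolynomial (Fin 5) ℂ → ℂ} (h : φ ∈ polyFun) (h' : ψ ∈ polyFun) :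
    (fun F => φ F * ψ F) ∈ polyFun := polyFun.mul_mem h h'

lemma polyFun_sub {φ ψ : MvPolynomial (Fin 5) ℂ → ℂ} (h : φ ∈ polyFun) (h' : ψ ∈ polyFun) :
    (fun F => φ F - ψ F) ∈ polyFun := polyFun.sub_mem h h'

lemma polyFun_sum {ι : Type*} (s : Finset ι) (φ : ι → MvPolynomial (Fin 5) ℂ → ℂ)
    (h : ∀ i ∈ s, φ i ∈ polyFun) : (fun F => ∑ i ∈ s, φ i F) ∈ polyFun := by
  have := polyFun.sum_mem h
  convert this using 1
  ext F; simp

lemma polyFun_prod {ι : Type*} (s : Finset ι) (φ : ι → MvPolynomial (Fin 5) ℂ → ℂ)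
    (h : ∀ i ∈ s, φ i ∈ polyFun) : (fun F => ∏ i ∈ s, φ i F) ∈ polyFun := by
  have := polyFun.prod_mem h
  convert this using 1
  ext F; simp

lemma polyFun_det {ι : Type*} [Fintype ι] [DecidableEq ι]
    (K : MvPolynomial (Fin 5) ℂ → Matrix ι ι ℂ)
    (h : ∀ i j, (fun F => K F i j) ∈ polyFun) : (fun F => (K F).det) ∈ polyFun := by
  simp only [Matrix.det_apply']
  exact polyFun_sum _ _ fun σ _ => polyFun_mul (polyFun_const _) (polyFun_prod _ _ fun i _ => h _ _)

lemma polyFun_adjugate {ι : Type*} [Fintype ι] [DecidableEq ι]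
    (K : MvPolynomial (Fin 5) ℂ → Matrix ι ι ℂ)
    (h : ∀ i j, (fun F => K F i j) ∈ polyFun) (i j : ι) :
    (fun F => (K F).adjugate i j) ∈ polyFun := by
  simp only [Matrix.adjugate_apply]
  apply polyFun_det
  intro a b
  by_cases haj : a = j
  · subst haj; simp only [Matrix.updateRow_self]; exact polyFun_const _
  · simp only [Matrix.updateRow_ne haj]; exact h _ _

lemma polyFun_coeff (m : Fin 5 →₀ ℕ) : (fun F => coeff m F) ∈ polyFun :=
  mem_polyFun.2 ⟨X m, fun F => by simp⟩

lemma polyFun_comp {φ : MvPolynomial (Fin 5) ℂ → ℂ} (hφ : φ ∈ polyFun)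
    (G : MvPolynomial (Fin 5) ℂ → MvPolynomial (Fin 5) ℂ)
    (hG : ∀ m, (fun F => coeff m (G F)) ∈ polyFun) : (fun F => φ (G F)) ∈ polyFun := by
  obtain ⟨P, hP⟩ := mem_polyFun.1 hφ
  simp only [hP]
  clear hP
  induction P using MvPolynomial.induction_on with
  | C a => simpa using polyFun_const a
  | add p q hp hq =>
    simp only [map_add]
    exact polyFun.add_mem hp hq
  | mul_X p i hp => simpa using polyFun_mul hp (hG i)

/-- The coefficients of `a ∂_j F` are polynomial functions. -/
lemma polyFun_coeff_mul_pderiv (a : MvPolynomial (Fin 5) ℂ) (j : Fin 5) (m : Fin 5 →₀ ℕ) :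
    (fun F => coeff m (a * pderiv j F)) ∈ polyFun := by
  classical
  simp only [coeff_mul, coeff_pderiv]
  exact polyFun_sum _ _ fun p _ => polyFun_mul (polyFun_const _)
    (polyFun_mul (polyFun_coeff _) (polyFun_const _))

lemma homogComp_mul (n k : ℕ) (a q : MvPolynomial (Fin 5) ℂ) (hq : q.IsHomogeneous k) :
    homogeneousComponent (n + k) (a * q) = homogeneousComponent n a * q := by
  induction a using MvPolynomial.induction_on' with
  | monomial d r =>
    have h1 : (monomial d r : MvPolynomial (Fin 5) ℂ).IsHomogeneous d.degree :=
      isHomogeneous_monomial r rfl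
    rw [homogeneousComponent_of_mem ((mem_homogeneousSubmodule _ _).2 (h1.mul hq)),
      homogeneousComponent_of_mem ((mem_homogeneousSubmodule _ _).2 h1)]
    by_cases h : n = d.degree
    · simp [h]
    · rw [if_neg (by omega), if_neg h, zero_mul]
  | add p q hp hq => simp [add_mul, hp, hq]

lemma pderiv_hom {F : MvPolynomial (Fin 5) ℂ} (hF : F.IsHomogeneous 3) (j : Fin 5) :
    (pderiv j F).IsHomogeneous 2 := hF.pderiv

/-- A homogeneous element of the Jacobian ideal has homogeneous coefficients. -/
lemma jac_hom {F b : MvPolynomial (Fin 5) ℂ} (hF : F.IsHomogeneous 3) {n : ℕ}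
    (hb : b.IsHomogeneous (n + 2)) (hbJ : b ∈ jacobianIdeal F) :
    ∃ a : Fin 5 → MvPolynomial (Fin 5) ℂ, (∀ j, (a j).IsHomogeneous n) ∧
      ∑ j, a j * pderiv j F = b := by
  obtain ⟨c, hc⟩ := Ideal.mem_span_range_iff_exists_fun.1 hbJ
  refine ⟨fun j => homogeneousComponent n (c j), fun j => homogeneousComponent_isHomogeneous _ _, ?_⟩
  have := homogeneousComponent_of_mem (m := n + 2) ((mem_homogeneousSubmodule _ _).2 hb)
  rw [if_pos rfl, ← hc, map_sum] at this
  simp only [homogComp_mul n 2 _ _ (pderiv_hom hF _)] at this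
  rw [this, hc]

/-- sum over degree-n monomials. -/
lemma eval_hom {p : MvPolynomial (Fin 5) ℂ} {n : ℕ} (hp : p.IsHomogeneous n) :
    ∑ m : {m : Fin 5 →₀ ℕ // m.degree = n}, monomial m.1 (coeff m.1 p) = p := by
  classical
  ext d
  rw [coeff_sum]
  simp only [coeff_monomial]
  by_cases hd : d.degree = n
  · rw [Finset.sum_eq_single ⟨d, hd⟩]
    · simp
    · intro b _ hb
      rw [if_neg]
      intro h; apply hb; exact Subtype.ext h
    · simp
  · rw [hp.coeff_eq_zero hd]
    apply Finset.sum_eq_zero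
    intro b _
    rw [if_neg]
    intro h; apply hd; rw [← h]; exact b.2

lemma smooth_open {F₀ : MvPolynomial (Fin 5) ℂ} (hF₀ : F₀.IsHomogeneous 3) (hs : SmoothForm F₀) :
    ∃ φ ∈ polyFun, φ F₀ ≠ 0 ∧ ∀ F : MvPolynomial (Fin 5) ℂ, F.IsHomogeneous 3 → φ F ≠ 0 →
      SmoothForm F := by
  classical
  have hrad : idealOfVars (Fin 5) ℂ ≤ (jacobianIdeal F₀).radical := by
    rw [← vanishingIdeal_zeroLocus_eq_radical (K := ℂ)]
    refine Ideal.span_le.2 ?_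
    rintro _ ⟨i, rfl⟩ x hx
    have : x = 0 := by
      apply hs
      intro j
      have := hx (pderiv j F₀) (Ideal.subset_span ⟨j, rfl⟩)
      simpa [aeval_eq_eval] using this
    simp [this]
  obtain ⟨n, hn⟩ := Ideal.exists_pow_le_of_le_radical_of_fg hrad (idealOfVars_fg _ _)
  have hmem : ∀ m : {m : Fin 5 →₀ ℕ // m.degree = n + 2},
      ∃ a : Fin 5 → MvPolynomial (Fin 5) ℂ, (∀ j, (a j).IsHomogeneous n) ∧
      ∑ j, a j * pderiv j F₀ = monomial m.1 1 := by
    intro m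
    apply jac_hom hF₀ (isHomogeneous_monomial _ m.2)
    apply hn
    rw [mem_pow_idealOfVars_iff]
    intro d hd
    have := support_monomial_subset hd
    simp at this
    rw [this, m.2]
    omega
  choose a ha hsum using hmem
  let K : MvPolynomial (Fin 5) ℂ → Matrix {m : Fin 5 →₀ ℕ // m.degree = n + 2}
      {m : Fin 5 →₀ ℕ // m.degree = n + 2} ℂ :=
    fun F => Matrix.of fun m m' => coeff m'.1 (∑ j, a m j * pderiv j F)
  refine ⟨fun F => (K F).det, polyFun_det _ ?_, ?_, ?_⟩
  · intro m m'
    simp only [K, Matrix.of_apply, coeff_sum]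
    exact polyFun_sum _ _ fun j _ => polyFun_coeff_mul_pderiv _ _ _
  · have : K F₀ = 1 := by
      ext m m'
      simp only [K, Matrix.of_apply, hsum, coeff_monomial, Matrix.one_apply, Subtype.ext_iff]
    simp [this]
  · intro F hF hdet x hx
    let v : {m : Fin 5 →₀ ℕ // m.degree = n + 2} → ℂ := fun m => eval x (monomial m.1 1)
    have hv : (K F).mulVec v = 0 := by
      ext m
      have hh : (∑ j, a m j * pderiv j F).IsHomogeneous (n + 2) :=
        IsHomogeneous.sum _ _ _ fun j _ => (ha m j).mul (pderiv_hom hF j)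
      have h1 := congrArg (eval x) (eval_hom hh)
      have h2 : eval x (∑ j, a m j * pderiv j F) = 0 := by simp [hx]
      rw [h2, map_sum] at h1
      simp only [Matrix.mulVec, dotProduct, K, Matrix.of_apply, v, Pi.zero_apply]
      rw [← h1]
      refine Finset.sum_congr rfl fun m' _ => ?_
      simp [eval_monomial]
    have hv0 := Matrix.eq_zero_of_mulVec_eq_zero hdet hv
    ext i
    have := congrFun hv0 ⟨Finsupp.single i (n + 2), by simp⟩
    change eval x (monomial (Finsupp.single i (n + 2)) 1) = 0 at this
    rw [eval_monomial, Finsupp.prod_single_index (by simp), one_mul] at this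
    exact pow_eq_zero_iff (by omega) |>.1 this

lemma coeff_pderiv_pow (i : Fin 5) (k : ℕ) (n : Fin 5 →₀ ℕ) : ∃ c : ℂ, c ≠ 0 ∧
    ∀ P : MvPolynomial (Fin 5) ℂ,
    coeff n ((((pderiv i).toLinearMap : Module.End ℂ (MvPolynomial (Fin 5) ℂ)) ^ k) P)
      = c * coeff (n + Finsupp.single i k) P := by
  induction k with
  | zero => exact ⟨1, one_ne_zero, fun P => by simp⟩
  | succ k ih =>
    obtain ⟨c, hc, h⟩ := ih
    refine ⟨c * (((n + Finsupp.single i k) i : ℕ) + 1), mul_ne_zero hc (Nat.cast_add_one_ne_zero _),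
      fun P => ?_⟩
    rw [pow_succ, Module.End.mul_apply, h]
    change c * coeff _ (pderiv i P) = _
    rw [coeff_pderiv, add_assoc, ← Finsupp.single_add]
    ring

lemma coeff_list (m : Fin 5 →₀ ℕ) (l : List (Fin 5)) : ∀ (n : Fin 5 →₀ ℕ), ∃ c : ℂ, c ≠ 0 ∧
    ∀ P : MvPolynomial (Fin 5) ℂ,
    coeff n ((l.map fun i => ((pderiv i).toLinearMap :
      Module.End ℂ (MvPolynomial (Fin 5) ℂ)) ^ (m i)).prod P)
      = c * coeff (n + (l.map fun i => Finsupp.single i (m i)).sum) P := by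
  induction l with
  | nil => exact fun n => ⟨1, one_ne_zero, fun P => by simp⟩
  | cons i l ih =>
    intro n
    obtain ⟨c, hc, h⟩ := coeff_pderiv_pow i (m i) n
    obtain ⟨c', hc', h'⟩ := ih (n + Finsupp.single i (m i))
    refine ⟨c * c', mul_ne_zero hc hc', fun P => ?_⟩
    rw [List.map_cons, List.prod_cons, Module.End.mul_apply, h, h', List.map_cons, List.sum_cons,
      add_assoc, mul_assoc]

lemma polar_weights : ∃ w : (Fin 5 →₀ ℕ) → ℂ, (∀ m, w m ≠ 0) ∧
    ∀ P G : MvPolynomial (Fin 5) ℂ, G.IsHomogeneous 3 → polarPair P G =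
      ∑ m : {m : Fin 5 →₀ ℕ // m.degree = 3}, w m.1 * coeff m.1 P * coeff m.1 G := by
  classical
  have key : ∀ m : Fin 5 →₀ ℕ, ∃ c : ℂ, c ≠ 0 ∧ ∀ P : MvPolynomial (Fin 5) ℂ,
      constantCoeff ((List.ofFn fun i : Fin 5 =>
      ((pderiv i).toLinearMap : Module.End ℂ (MvPolynomial (Fin 5) ℂ)) ^ (m i)).prod P)
      = c * coeff m P := by
    intro m
    obtain ⟨c, hc, h⟩ := coeff_list m (List.finRange 5) 0
    refine ⟨c, hc, fun P => ?_⟩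
    have := h P
    rw [← List.ofFn_eq_map, ← List.ofFn_eq_map, List.sum_ofFn, Finsupp.univ_sum_single, zero_add] at this
    exact this
  choose w hw h using key
  refine ⟨w, hw, fun P G hG => ?_⟩
  unfold polarPair
  rw [map_sum]
  have h1 : ∀ m ∈ G.support, constantCoeff (G.coeff m •
    ((List.ofFn fun i : Fin 5 =>
      ((pderiv i).toLinearMap : Module.End ℂ (MvPolynomial (Fin 5) ℂ)) ^ (m i)).prod P))
      = w m * coeff m P * coeff m G := by
    intro m _
    rw [constantCoeff_smul, h, smul_eq_mul]
    ring
  rw [Finset.sum_congr rfl h1]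
  have h2 : ∑ m : {m : Fin 5 →₀ ℕ // m.degree = 3}, w m.1 * coeff m.1 P * coeff m.1 G
      = ∑ m ∈ Finset.univ.map (Function.Embedding.subtype fun m : Fin 5 →₀ ℕ => m.degree = 3),
        w m * coeff m P * coeff m G := by
    rw [Finset.sum_map]; rfl
  rw [h2]
  apply Finset.sum_subset
  · intro m hm
    simp only [Finset.mem_map, Finset.mem_univ, true_and]
    refine ⟨⟨m, ?_⟩, rfl⟩
    by_contra hne
    exact (mem_support_iff.1 hm) (hG.coeff_eq_zero hne)
  · intro m _ hm
    rw [notMem_support_iff.1 hm, mul_zero]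

lemma s13 (f : Fin 5 → Fin 5 → Fin 5 → ℂ) :
    ∑ a, ∑ b, ∑ c, f a b c = ∑ c, ∑ b, ∑ a, f a b c := by
  rw [Finset.sum_comm]
  rw [Finset.sum_congr rfl fun b _ => Finset.sum_comm]
  rw [Finset.sum_comm]

lemma s14 (f : Fin 5 → Fin 5 → Fin 5 → Fin 5 → ℂ) :
    ∑ a, ∑ b, ∑ c, ∑ d, f a b c d = ∑ d, ∑ b, ∑ c, ∑ a, f a b c d := by
  rw [Finset.sum_congr rfl fun a _ => Finset.sum_congr rfl fun b _ => Finset.sum_comm]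
  rw [s13]
  rw [Finset.sum_congr rfl fun a _ => Finset.sum_congr rfl fun b _ => Finset.sum_comm]

lemma syz_zero {F : MvPolynomial (Fin 5) ℂ} (hF : F.IsHomogeneous 3) (hs : SmoothForm F)
    (c : Fin 5 → Fin 5 → ℂ) (hc : ∑ i, ∑ j, C (c i j) * (X i * pderiv j F) = 0) : c = 0 := by
  classical
  let t : Fin 5 → Fin 5 → Fin 5 → ℂ := fun p q r =>
    constantCoeff (pderiv p (pderiv q (pderiv r F)))
  have ht : ∀ p q r, pderiv p (pderiv q (pderiv r F)) = C (t p q r) := by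
    intro p q r
    have h0 : (pderiv p (pderiv q (pderiv r F))).IsHomogeneous 0 := hF.pderiv.pderiv.pderiv
    have h1 := homogeneousComponent_eq_self h0
    rw [homogeneousComponent_zero] at h1
    exact h1.symm
  have comm : ∀ (p q : Fin 5) (G : MvPolynomial (Fin 5) ℂ),
      pderiv p (pderiv q G) = pderiv q (pderiv p G) := by
    intro p q G
    ext m
    simp only [coeff_pderiv]
    by_cases hpq : p = q
    · subst hpq; rfl
    · have : q ≠ p := fun h => hpq h.symm
      simp [hpq, this]
      rw [add_right_comm]
      ring
  -- quadrics
  have hquad : ∀ (x : Fin 5 → ℂ) (r : Fin 5),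
      2 * eval x (pderiv r F) = ∑ q, ∑ p, x q * x p * t p q r := by
    intro x r
    have h1 := congrArg (eval x) (IsHomogeneous.sum_X_mul_pderiv (pderiv_hom hF r))
    have h2 : ∀ q, ∑ p, x p * t p q r = eval x (pderiv q (pderiv r F)) := by
      intro q
      have h3 : (pderiv q (pderiv r F)).IsHomogeneous 1 := (pderiv_hom hF r).pderiv
      have := congrArg (eval x) (IsHomogeneous.sum_X_mul_pderiv h3)
      simpa [ht] using this
    simp only [mul_assoc, ← Finset.mul_sum, h2]
    simpa using h1.symm
  have hX : ∀ r i : Fin 5, pderiv r (X i : MvPolynomial (Fin 5) ℂ) = C (if i = r then 1 else 0) := by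
    intro r i
    rw [pderiv_X, Pi.single_apply]
    split_ifs <;> simp
  have hone : ∀ p q r i j : Fin 5, constantCoeff (pderiv p (pderiv q (pderiv r (X i * pderiv j F))))
      = (if i = p then t j q r else 0) + (if i = q then t p j r else 0)
        + (if i = r then t p q j else 0) := by
    intro p q r i j
    have e1 : t j q r = t q r j := by
      change constantCoeff _ = constantCoeff _
      rw [comm j q, comm j r]
    have e2 : t p j r = t p r j := by
      change constantCoeff _ = constantCoeff _
      rw [comm j r]
    rw [e1, e2]
    simp only [pderiv_mul, map_add, hX, pderiv_C, ht, map_mul, constantCoeff_C, constantCoeff_X,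
      map_zero, zero_mul, mul_zero, zero_add, add_zero, ite_mul, one_mul]
    ring
  have hsyz : ∀ p q r, ∑ l, (c p l * t l q r + c q l * t p l r + c r l * t p q l) = 0 := by
    intro p q r
    have := congrArg (fun G => constantCoeff (pderiv p (pderiv q (pderiv r G)))) hc
    simp only [map_sum, map_zero, pderiv_C_mul, map_mul, constantCoeff_C, hone] at this
    rw [Finset.sum_comm] at this
    rw [← this]
    refine Finset.sum_congr rfl fun l _ => ?_
    simp only [mul_add, Finset.sum_add_distrib, mul_ite, mul_zero, Finset.sum_ite_eq', Finset.mem_univ, if_true]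
  let T : (Fin 5 → ℂ) →ₗ[ℂ] (Fin 5 → ℂ) →ₗ[ℂ] (Fin 5 → ℂ) →ₗ[ℂ] ℂ :=
    ∑ p, ∑ q, ∑ r, t p q r • (LinearMap.proj p : (Fin 5 → ℂ) →ₗ[ℂ] ℂ).smulRight
      ((LinearMap.proj q : (Fin 5 → ℂ) →ₗ[ℂ] ℂ).smulRight
        (LinearMap.proj r : (Fin 5 → ℂ) →ₗ[ℂ] ℂ))
  have hT : ∀ u v w, T u v w = ∑ p, ∑ q, ∑ r, u p * v q * w r * t p q r := by
    intro u v w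
    simp only [T, LinearMap.sum_apply, LinearMap.smul_apply, LinearMap.smulRight_apply,
      LinearMap.proj_apply, smul_eq_mul]
    refine Finset.sum_congr rfl fun p _ => Finset.sum_congr rfl fun q _ =>
      Finset.sum_congr rfl fun r _ => ?_
    ring
  let A : Module.End ℂ (Fin 5 → ℂ) := Matrix.vecMulLinear (Matrix.of c)
  have hAv : ∀ u l, A u l = ∑ p, u p * c p l := fun u l => rfl
  have hA : A = 0 := by
    apply stab_zero T A
    · intro u v w
      simp only [hT, hAv]
      have e1 : ∑ l, ∑ q, ∑ r, (∑ p, u p * c p l) * v q * w r * t l q r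
          = ∑ p, ∑ q, ∑ r, ∑ l, u p * v q * w r * (c p l * t l q r) := by
        simp only [Finset.sum_mul]
        rw [s14]
        refine Finset.sum_congr rfl fun p _ => Finset.sum_congr rfl fun q _ =>
          Finset.sum_congr rfl fun r _ => Finset.sum_congr rfl fun l _ => ?_
        ring
      have e2 : ∑ p, ∑ l, ∑ r, u p * (∑ q, v q * c q l) * w r * t p l r
          = ∑ p, ∑ q, ∑ r, ∑ l, u p * v q * w r * (c q l * t p l r) := by
        simp only [Finset.sum_mul, Finset.mul_sum]
        refine Finset.sum_congr rfl fun p _ => ?_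
        rw [s13]
        refine Finset.sum_congr rfl fun q _ =>
          Finset.sum_congr rfl fun r _ => Finset.sum_congr rfl fun l _ => ?_
        ring
      have e3 : ∑ p, ∑ q, ∑ l, u p * v q * (∑ r, w r * c r l) * t p q l
          = ∑ p, ∑ q, ∑ r, ∑ l, u p * v q * w r * (c r l * t p q l) := by
        simp only [Finset.sum_mul, Finset.mul_sum]
        refine Finset.sum_congr rfl fun p _ => Finset.sum_congr rfl fun q _ => ?_
        rw [Finset.sum_comm]
        refine Finset.sum_congr rfl fun r _ => Finset.sum_congr rfl fun l _ => ?_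
        ring
      rw [e1, e2, e3]
      simp only [← Finset.sum_add_distrib, ← mul_add, ← Finset.mul_sum, hsyz, mul_zero,
        Finset.sum_const_zero]
    · intro v hv
      apply hs
      intro r
      have h1 := hv (Pi.single r 1)
      rw [hT] at h1
      have h2 := hquad v r
      have h3 : ∑ q, ∑ p, v q * v p * t p q r = 0 := by
        rw [Finset.sum_comm, ← h1]
        refine Finset.sum_congr rfl fun p _ => Finset.sum_congr rfl fun q _ => ?_
        rw [Finset.sum_eq_single r]
        · rw [Pi.single_eq_same]; ring
        · intro b _ hb; simp [hb]
        · simp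
      rw [h3] at h2
      simpa using h2
  ext p l
  have := congrFun (LinearMap.congr_fun hA (Pi.single p 1)) l
  rw [hAv, Finset.sum_eq_single p] at this
  · simpa using this
  · intro b _ hb; simp [hb]
  · simp

lemma hom1_eq {a : MvPolynomial (Fin 5) ℂ} (ha : a.IsHomogeneous 1) :
    ∃ c : Fin 5 → ℂ, a = ∑ i, C (c i) * X i := by
  have h : a ∈ homogeneousSubmodule (Fin 5) ℂ 1 := ha
  rw [homogeneousSubmodule_one_eq_span_X, Submodule.mem_span_range_iff_exists_fun] at h
  obtain ⟨c, hc⟩ := h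
  exact ⟨c, by rw [← hc]; simp [smul_eq_C_mul]⟩

lemma exists_right_inv {ι κ : Type*} [Fintype ι] [Fintype κ] [DecidableEq ι] (M : Matrix ι κ ℂ)
    (h : ∀ c, Matrix.vecMul c M = 0 → c = 0) : ∃ N : Matrix κ ι ℂ, M * N = 1 := by
  rw [← Matrix.mulVec_surjective_iff_exists_right_inverse]
  have hinj : Function.Injective M.vecMul :=
    (injective_iff_map_eq_zero (Matrix.vecMulLinear M)).2 h
  have hr := (Matrix.vecMul_injective_iff.1 hinj).rank_matrix
  have : LinearMap.range M.mulVecLin = ⊤ := by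
    apply Submodule.eq_top_of_finrank_eq
    rw [Module.finrank_fintype_fun_eq_card]
    exact hr
  exact LinearMap.range_eq_top.1 this

lemma calU_open {F₀ : MvPolynomial (Fin 5) ℂ} (h₀ : F₀ ∈ calU) :
    ∃ φ ∈ polyFun, φ F₀ ≠ 0 ∧ ∀ F ∈ homogeneousSubmodule (Fin 5) ℂ 3, φ F ≠ 0 → F ∈ calU := by
  classical
  obtain ⟨hF₀, hs, G₀, ⟨hG₀, hperp⟩, hGs⟩ := h₀
  rw [mem_homogeneousSubmodule] at hF₀ hG₀
  obtain ⟨w, hw, hpol⟩ := polar_weights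
  obtain ⟨φ, hφ, hφ0, hφs⟩ := smooth_open hF₀ hs
  obtain ⟨ψ, hψ, hψ0, hψs⟩ := smooth_open hG₀ hGs
  let M : MvPolynomial (Fin 5) ℂ → Matrix (Fin 5 × Fin 5) {m : Fin 5 →₀ ℕ // m.degree = 3} ℂ :=
    fun F => Matrix.of fun ij m => w m.1 * coeff m.1 (X ij.1 * pderiv ij.2 F)
  have hMp : ∀ ij m, (fun F => M F ij m) ∈ polyFun := fun ij m =>
    polyFun_mul (polyFun_const _) (polyFun_coeff_mul_pderiv _ _ _)
  obtain ⟨N, hN⟩ := exists_right_inv (M F₀) (by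
    intro c hc
    have hz : ∑ i, ∑ j, C (c (i, j)) * (X i * pderiv j F₀) = 0 := by
      have hh : (∑ i, ∑ j, C (c (i, j)) * (X i * pderiv j F₀)).IsHomogeneous 3 :=
        IsHomogeneous.sum _ _ _ fun i _ => IsHomogeneous.sum _ _ _ fun j _ =>
          ((isHomogeneous_X _ i).mul (pderiv_hom hF₀ j)).C_mul _
      ext m
      by_cases hm : m.degree = 3
      · have := congrFun hc ⟨m, hm⟩
        simp only [Matrix.vecMul, dotProduct, M, Matrix.of_apply, Pi.zero_apply] at this
        rw [Fintype.sum_prod_type] at this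
        have h2 : w m * coeff m (∑ i, ∑ j, C (c (i, j)) * (X i * pderiv j F₀)) = 0 := by
          rw [← this]
          simp only [coeff_sum, coeff_C_mul, Finset.mul_sum]
          refine Finset.sum_congr rfl fun p _ => Finset.sum_congr rfl fun q _ => ?_
          ring
        simpa [hw m] using h2
      · rw [hh.coeff_eq_zero hm, coeff_zero]
    have := syz_zero hF₀ hs (fun i j => c (i, j)) hz
    ext ⟨i, j⟩
    exact congrFun (congrFun this i) j)
  let g₀ : {m : Fin 5 →₀ ℕ // m.degree = 3} → ℂ := fun m => coeff m.1 G₀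
  let g : MvPolynomial (Fin 5) ℂ → {m : Fin 5 →₀ ℕ // m.degree = 3} → ℂ := fun F =>
    (M F * N).det • g₀ - N.mulVec ((M F * N).adjugate.mulVec ((M F).mulVec g₀))
  let G : MvPolynomial (Fin 5) ℂ → MvPolynomial (Fin 5) ℂ := fun F => ∑ m, monomial m.1 (g F m)
  have hGhom : ∀ F, (G F).IsHomogeneous 3 := fun F =>
    IsHomogeneous.sum _ _ _ fun m _ => isHomogeneous_monomial _ m.2
  have hGc : ∀ F (m : {m : Fin 5 →₀ ℕ // m.degree = 3}), coeff m.1 (G F) = g F m := by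
    intro F m
    simp only [G, coeff_sum, coeff_monomial]
    rw [Finset.sum_eq_single m]
    · simp
    · intro b _ hb
      rw [if_neg]
      intro h; exact hb (Subtype.ext h)
    · simp
  have hpm : ∀ F H : MvPolynomial (Fin 5) ℂ, H.IsHomogeneous 3 → ∀ i j,
      polarPair (X i * pderiv j F) H = (M F).mulVec (fun m => coeff m.1 H) (i, j) := by
    intro F H hH i j
    rw [hpol _ _ hH]
    rfl
  have hMg : ∀ F, (M F).mulVec (g F) = 0 := by
    intro F
    simp only [g, Matrix.mulVec_sub, Matrix.mulVec_smul, Matrix.mulVec_mulVec]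
    rw [← Matrix.mul_assoc (M F), ← Matrix.mul_assoc (M F * N), Matrix.mul_adjugate, Matrix.smul_mul, Matrix.one_mul,
      Matrix.smul_mulVec, sub_self]
  have hMF₀ : (M F₀).mulVec g₀ = 0 := by
    ext ⟨i, j⟩
    rw [← hpm F₀ G₀ hG₀ i j]
    apply hperp
    refine ⟨Ideal.mul_mem_left _ _ (Ideal.subset_span ⟨j, rfl⟩), ?_⟩
    rw [mem_homogeneousSubmodule]
    exact (isHomogeneous_X _ i).mul (pderiv_hom hF₀ j)
  have hGF₀ : G F₀ = G₀ := by
    rw [← eval_hom hG₀]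
    refine Finset.sum_congr rfl fun m _ => ?_
    simp only [g, hMF₀, hN, Matrix.mulVec_zero, Matrix.det_one, one_smul, sub_zero, g₀]
  have hKp : ∀ a b, (fun F => (M F * N) a b) ∈ polyFun := by
    intro a b
    simp only [Matrix.mul_apply]
    exact polyFun_sum _ _ fun m _ => polyFun_mul (hMp _ _) (polyFun_const _)
  have hgp : ∀ m, (fun F => g F m) ∈ polyFun := by
    intro m
    simp only [g, Pi.sub_apply, Pi.smul_apply, smul_eq_mul, Matrix.mulVec, dotProduct]
    refine polyFun_sub (polyFun_mul (polyFun_det _ hKp) (polyFun_const _)) ?_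
    refine polyFun_sum _ _ fun a _ => polyFun_mul (polyFun_const _) ?_
    refine polyFun_sum _ _ fun b _ => polyFun_mul (polyFun_adjugate _ hKp _ _) ?_
    exact polyFun_sum _ _ fun m _ => polyFun_mul (hMp _ _) (polyFun_const _)
  have hGp : ∀ m, (fun F => coeff m (G F)) ∈ polyFun := by
    intro m
    by_cases hm : m.degree = 3
    · have := hgp ⟨m, hm⟩
      simp only [← hGc] at this
      exact this
    · simp only [fun F => (hGhom F).coeff_eq_zero hm]
      exact polyFun_const 0
  refine ⟨fun F => φ F * ψ (G F), polyFun_mul hφ (polyFun_comp hψ G hGp), ?_, ?_⟩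
  · simp only [hGF₀]
    exact mul_ne_zero hφ0 hψ0
  · intro F hF hne
    have hF' : F.IsHomogeneous 3 := hF
    refine ⟨hF, hφs F hF (left_ne_zero_of_mul hne), G F, ⟨hGhom F, ?_⟩,
      hψs _ (hGhom F) (right_ne_zero_of_mul hne)⟩
    rintro b ⟨hbJ, hb⟩
    have hb' : b.IsHomogeneous (1 + 2) := hb
    obtain ⟨a, ha, rfl⟩ := jac_hom hF' hb' hbJ
    choose c hc using fun j => hom1_eq (ha j)
    have hzero : ∀ i j, ∑ m : {m : Fin 5 →₀ ℕ // m.degree = 3},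
        w m.1 * coeff m.1 (X i * pderiv j F) * coeff m.1 (G F) = 0 := by
      intro i j
      rw [← hpol _ _ (hGhom F), hpm F _ (hGhom F)]
      simp only [hGc]
      exact congrFun (hMg F) (i, j)
    rw [hpol _ _ (hGhom F)]
    have hexp : ∀ m, coeff m (∑ j, a j * pderiv j F)
        = ∑ j, ∑ i, c j i * coeff m (X i * pderiv j F) := by
      intro m
      rw [coeff_sum]
      refine Finset.sum_congr rfl fun j _ => ?_
      rw [hc j, Finset.sum_mul, coeff_sum]
      refine Finset.sum_congr rfl fun i _ => ?_
      rw [mul_assoc, coeff_C_mul]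
    simp only [hexp, Finset.mul_sum, Finset.sum_mul]
    rw [Finset.sum_comm]
    refine Finset.sum_eq_zero fun j _ => ?_
    rw [Finset.sum_comm]
    refine Finset.sum_eq_zero fun i _ => ?_
    rw [← mul_zero (c j i), ← hzero i j, Finset.mul_sum]
    refine Finset.sum_congr rfl fun m _ => ?_
    ring

/-- `𝒰` is Zariski open in `S₃`: its complement inside `S₃` is the common zero locus of a
family of polynomial functions in the (linear) coefficient coordinates of `F`. -/
theorem calU_zariski_open :
    ∃ (ι : Type) (P : ι → MvPolynomial ((Fin 5) →₀ ℕ) ℂ),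
      ∀ F ∈ homogeneousSubmodule (Fin 5) ℂ 3,
        (F ∉ calU ↔ ∀ i, eval (fun m => coeff m F) (P i) = 0) := by
  refine ⟨{P : MvPolynomial ((Fin 5) →₀ ℕ) ℂ //
    ∀ F ∈ homogeneousSubmodule (Fin 5) ℂ 3, F ∉ calU → eval (fun m => coeff m F) P = 0},
    Subtype.val, fun F hF => ⟨fun h P => P.2 F hF h, fun h hU => ?_⟩⟩
  obtain ⟨φ, hφ, h0, h1⟩ := calU_open hU
  obtain ⟨P, hP⟩ := mem_polyFun.1 hφ
  apply h0
  rw [hP]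
  refine h ⟨P, fun F' hF' hn => ?_⟩
  by_contra hne
  exact hn (h1 F' hF' (by rwa [hP]))
end

section
/- For every smooth cubic form F ∈ ℂ[x₀,…,x₄], there exists a quadratic form Q ∈ S_2 such that the pair (F,Q) defines a smooth complete intersection surface in ℙ⁴ and (J_{F,3}:Q) = 0, i.e., the only linear form a ∈ S_1 with aQ ∈ J_{F,3} is a = 0. (Theorem 1.4.) -/
open MvPolynomial

/-- `(F, Q)` defines a smooth complete intersection: at every nonzero common zero `p` of
`F` and `Q` the gradients `∇F(p)` and `∇Q(p)` are linearly independent. -/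
def SmoothCI (F Q : MvPolynomial (Fin 5) ℂ) : Prop :=
  ∀ p : Fin 5 → ℂ, p ≠ 0 → eval p F = 0 → eval p Q = 0 →
    LinearIndependent ℂ ![fun i => eval p (pderiv i F), fun i => eval p (pderiv i Q)]

/-- Three polynomials in four variables that vanish at the origin have another common zero. -/
theorem exists_common_zero (f : Fin 3 → MvPolynomial (Fin 4) ℂ) (hf : ∀ i, eval 0 (f i) = 0) :
    ∃ x : Fin 4 → ℂ, x ≠ 0 ∧ ∀ i, eval x (f i) = 0 := by
  by_contra hcon
  push Not at hcon
  have hdim : ringKrullDim (MvPolynomial (Fin 4) ℂ) = (4 : ℕ) := by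
    rw [MvPolynomial.ringKrullDim_of_isNoetherianRing, ringKrullDim_eq_zero_of_field]; simp
  have : FiniteRingKrullDim (MvPolynomial (Fin 4) ℂ) := by
    rw [finiteRingKrullDim_iff_ne_bot_and_top, hdim]
    exact ⟨WithBot.coe_ne_bot, by decide⟩
  obtain ⟨P, hP, hPh⟩ := Ideal.exists_isMaximal_height (R := MvPolynomial (Fin 4) ℂ)
  obtain ⟨x, hx⟩ := isMaximal_iff_eq_vanishingIdeal_singleton.1 hP
  let g : Fin 3 → MvPolynomial (Fin 4) ℂ := fun i => aeval (fun j => X j - C (x j)) (f i)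
  have hg : ∀ i z, eval z (g i) = eval (fun j => z j - x j) (f i) := by
    intro i z
    have h := eval₂_comp_left (eval z) (C) (fun j => X j - C (x j)) (f i)
    simp only [g, aeval_def]
    rw [MvPolynomial.algebraMap_eq, h]
    have h1 : (eval z).comp (C : ℂ →+* MvPolynomial (Fin 4) ℂ) = RingHom.id ℂ := by
      ext; simp
    have h3 : (⇑(eval z) ∘ fun j => X j - C (x j)) = fun j => z j - x j := by
      funext j; simp
    rw [h1, h3]
    rfl
  have hz : zeroLocus ℂ (Ideal.span (Set.range g)) = {x} := by
    ext z
    rw [zeroLocus_span]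
    simp only [Set.mem_ofPred_eq, Set.mem_range, forall_exists_index, forall_apply_eq_imp_iff,
      Set.mem_singleton_iff, aeval_eq_eval]
    constructor
    · intro h
      by_contra hne
      obtain ⟨i, hi⟩ := hcon (fun j => z j - x j) (by
        intro h0; apply hne; funext j; exact sub_eq_zero.1 (congrFun h0 j))
      exact hi (by rw [← hg]; exact h i)
    · rintro rfl i
      have := hg i z
      have h2 : eval z (g i) = 0 := by rw [this]; simpa using hf i
      exact h2
  have hrad : (Ideal.span (Set.range g)).radical = P := by
    rw [← vanishingIdeal_zeroLocus_eq_radical (K := ℂ), hz, hx]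
  have hmin : P ∈ (Ideal.span (Set.range g)).minimalPrimes := by
    refine ⟨⟨hP.isPrime, hrad ▸ Ideal.le_radical⟩, ?_⟩
    rintro Q ⟨hQ, hIQ⟩ _
    rw [← hrad]
    exact hQ.radical_le_iff.2 hIQ
  have h1 := Ideal.height_le_card_of_mem_minimalPrimes_span (Set.finite_range g) hmin
  have h2 : (Set.range g).ncard ≤ 3 := by
    rw [← Set.image_univ]
    refine (Set.ncard_image_le Set.finite_univ).trans ?_
    simp [Set.ncard_univ]
  rw [hdim] at hPh
  have h3 : P.height = (4 : ℕ) := WithBot.coe_injective (hPh.trans rfl)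
  rw [h3] at h1
  have h4 : (4 : ℕ) ≤ (Set.range g).ncard := by exact_mod_cast h1
  omega

theorem cyc_of_cubic_zero {n : ℕ} (T : Fin n → Fin n → Fin n → ℂ)
    (sym : ∀ i j k, T i j k = T i k j)
    (h : ∀ y : Fin n → ℂ, ∑ i, ∑ j, ∑ k, T i j k * (y i * y j * y k) = 0) (i j k : Fin n) :
    T i j k + T j k i + T k i j = 0 := by
  have key : ∀ a b c : Fin n → ℂ, ∑ i, ∑ j, ∑ k, T i j k *
      (a i * b j * c k + a i * c j * b k + b i * c j * a k + b i * a j * c k + c i * a j * b k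
        + c i * b j * a k) = 0 := by
    intro a b c
    have h1 := h (a + b + c)
    have h2 := h (a + b)
    have h3 := h (a + c)
    have h4 := h (b + c)
    have h5 := h a
    have h6 := h b
    have h7 := h c
    have : (∑ i, ∑ j, ∑ k, T i j k *
      (a i * b j * c k + a i * c j * b k + b i * c j * a k + b i * a j * c k + c i * a j * b k
        + c i * b j * a k)) =
       (∑ i, ∑ j, ∑ k, T i j k * ((a + b + c) i * (a + b + c) j * (a + b + c) k))
       - (∑ i, ∑ j, ∑ k, T i j k * ((a + b) i * (a + b) j * (a + b) k))
       - (∑ i, ∑ j, ∑ k, T i j k * ((a + c) i * (a + c) j * (a + c) k))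
       - (∑ i, ∑ j, ∑ k, T i j k * ((b + c) i * (b + c) j * (b + c) k))
       + (∑ i, ∑ j, ∑ k, T i j k * (a i * a j * a k))
       + (∑ i, ∑ j, ∑ k, T i j k * (b i * b j * b k))
       + (∑ i, ∑ j, ∑ k, T i j k * (c i * c j * c k)) := by
      simp only [← Finset.sum_add_distrib, ← Finset.sum_sub_distrib]
      refine Finset.sum_congr rfl fun i _ => Finset.sum_congr rfl fun j _ =>
        Finset.sum_congr rfl fun k _ => ?_
      simp only [Pi.add_apply]
      ring
    rw [this, h1, h2, h3, h4, h5, h6, h7]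
    ring
  have h8 := key (Pi.single i 1) (Pi.single j 1) (Pi.single k 1)
  simp only [mul_add, Finset.sum_add_distrib, Pi.single_apply, mul_ite, mul_one, mul_zero,
    Finset.sum_ite_eq', Finset.mem_univ, if_true] at h8
  have s1 := sym i j k
  have s2 := sym j k i
  have s3 := sym k i j
  linear_combination (1/2 : ℂ) * h8 + (1/2 : ℂ) * (s1 + s2 + s3)

/-- Quadratic functions. -/
def IsQ {n : ℕ} (f : (Fin n → ℂ) → ℂ) : Prop :=
  ∃ B : Fin n → Fin n → ℂ, ∀ x, f x = ∑ i, ∑ j, B i j * x i * x j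

theorem IsQ.symm_form {n : ℕ} {f : (Fin n → ℂ) → ℂ} (h : IsQ f) :
    ∃ B : Fin n → Fin n → ℂ, (∀ i j, B i j = B j i) ∧ ∀ x, f x = ∑ i, ∑ j, B i j * (x i * x j) := by
  obtain ⟨B, hB⟩ := h
  refine ⟨fun i j => (B i j + B j i) / 2, fun i j => by ring, fun x => ?_⟩
  have h1 : f x = ∑ i, ∑ j, B j i * x j * x i := by rw [hB, Finset.sum_comm]
  have h2 : f x = (f x + f x) / 2 := by ring
  rw [h2]
  nth_rewrite 1 [hB x]
  rw [h1, ← Finset.sum_add_distrib, Finset.sum_div]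
  refine Finset.sum_congr rfl fun i _ => ?_
  rw [← Finset.sum_add_distrib, Finset.sum_div]
  refine Finset.sum_congr rfl fun j _ => ?_
  ring

theorem IsQ.comp_mulVec {n m : ℕ} {f : (Fin n → ℂ) → ℂ} (h : IsQ f) (M : Matrix (Fin n) (Fin m) ℂ) :
    IsQ (fun x => f (M.mulVec x)) := by
  obtain ⟨B, hB⟩ := h
  refine ⟨fun a b => ∑ i, ∑ j, B i j * M i a * M j b, fun x => ?_⟩
  beta_reduce
  rw [hB]
  simp only [Matrix.mulVec, dotProduct, Finset.sum_mul, Finset.mul_sum]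
  have e1 : ∀ g : Fin n → Fin n → Fin m → Fin m → ℂ, ∑ i, ∑ j, ∑ a, ∑ b, g i j a b =
      ∑ a, ∑ b, ∑ i, ∑ j, g i j a b := by
    intro g
    calc _ = ∑ i, ∑ a, ∑ j, ∑ b, g i j a b :=
          Finset.sum_congr rfl fun i _ => Finset.sum_comm
      _ = ∑ a, ∑ i, ∑ j, ∑ b, g i j a b := Finset.sum_comm
      _ = ∑ a, ∑ i, ∑ b, ∑ j, g i j a b :=
          Finset.sum_congr rfl fun a _ => Finset.sum_congr rfl fun i _ => Finset.sum_comm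
      _ = _ := Finset.sum_congr rfl fun a _ => Finset.sum_comm
  have e2 := e1 (fun i j a b => B i j * M i a * M j b * x a * x b)
  rw [← e2]
  refine Finset.sum_congr rfl fun i _ => Finset.sum_congr rfl fun j _ => ?_
  rw [Finset.sum_comm]
  refine Finset.sum_congr rfl fun a _ => Finset.sum_congr rfl fun b _ => ?_
  ring

theorem IsQ.sum_smul {n m : ℕ} {f : Fin m → (Fin n → ℂ) → ℂ} (h : ∀ k, IsQ (f k)) (c : Fin m → ℂ) :
    IsQ (fun x => ∑ k, c k * f k x) := by
  choose B hB using h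
  refine ⟨fun i j => ∑ k, c k * B k i j, fun x => ?_⟩
  simp only [hB, Finset.sum_mul, Finset.mul_sum]
  rw [Finset.sum_comm]
  refine Finset.sum_congr rfl fun i _ => ?_
  rw [Finset.sum_comm]
  refine Finset.sum_congr rfl fun j _ => Finset.sum_congr rfl fun k _ => ?_
  ring

theorem IsQ.poly {n : ℕ} {f : (Fin n → ℂ) → ℂ} (h : IsQ f) :
    ∃ p : MvPolynomial (Fin n) ℂ, ∀ x, eval x p = f x := by
  obtain ⟨B, hB⟩ := h
  exact ⟨∑ i, ∑ j, C (B i j) * X i * X j, fun x => by simp [hB, map_sum]⟩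

theorem IsQ.zero {n : ℕ} {f : (Fin n → ℂ) → ℂ} (h : IsQ f) : f 0 = 0 := by
  obtain ⟨B, hB⟩ := h
  simp [hB]

/-- a quadratic function has a zero on a curve whose leading vector is not a zero -/
theorem IsQ.exists_root {n : ℕ} {f : (Fin n → ℂ) → ℂ} (h : IsQ f) (P : Fin n → Polynomial ℂ) (k : ℕ)
    (hk : 1 ≤ k) (hP : ∀ i, (P i).natDegree ≤ k) (hf : f (fun i => (P i).coeff k) ≠ 0) :
    ∃ t, f (fun i => (P i).eval t) = 0 := by
  obtain ⟨B, hB⟩ := h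
  let g : Polynomial ℂ := ∑ i, ∑ j, Polynomial.C (B i j) * (P i * P j)
  have hg : g.coeff (k + k) = f (fun i => (P i).coeff k) := by
    rw [hB]
    simp only [g, Polynomial.finsetSum_coeff, Polynomial.coeff_C_mul]
    refine Finset.sum_congr rfl fun i _ => Finset.sum_congr rfl fun j _ => ?_
    rw [Polynomial.coeff_mul_add_eq_of_natDegree_le (hP i) (hP j)]
    ring
  have hd : g.degree ≠ 0 := by
    intro h0
    apply hf
    rw [← hg, Polynomial.eq_C_of_degree_eq_zero h0, Polynomial.coeff_C]
    rw [if_neg (by omega)]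
  obtain ⟨t, ht⟩ := IsAlgClosed.exists_root g hd
  refine ⟨t, ?_⟩
  rw [hB]
  have : g.eval t = 0 := ht
  simp only [g, Polynomial.eval_finsetSum, Polynomial.eval_mul, Polynomial.eval_C] at this
  rw [← this]
  refine Finset.sum_congr rfl fun i _ => Finset.sum_congr rfl fun j _ => by ring

theorem krylov_aux (A : Matrix (Fin 3) (Fin 3) ℂ) (w : Fin 3 → ℂ) (f : (Fin 4 → ℂ) → ℂ) (hf : IsQ f)
    (he : f ![0, 0, 0, 1] ≠ 0) (k : ℕ) (hk : 1 ≤ k) (Y : Fin 3 → Polynomial ℂ) (S : Polynomial ℂ)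
    (hY : ∀ i, (Y i).natDegree ≤ k) (hY' : ∀ i, (Y i).coeff k = 0) (hS : S.natDegree ≤ k)
    (hS' : S.coeff k = 1)
    (hne : ∀ t, (fun i => (Y i).eval t) ≠ 0)
    (hA : ∀ t, ∃ t' : ℂ, A.mulVec (fun i => (Y i).eval t) + S.eval t • w =
      t' • (fun i => (Y i).eval t)) :
    ∃ (y : Fin 3 → ℂ) (s t : ℂ), y ≠ 0 ∧ f ![y 0, y 1, y 2, s] = 0 ∧ A.mulVec y + s • w = t • y := by
  obtain ⟨t, ht⟩ := hf.exists_root ![Y 0, Y 1, Y 2, S] k hk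
    (by intro i; fin_cases i <;> simp [hY, hS])
    (by
      have : (fun i => ((![Y 0, Y 1, Y 2, S] : Fin 4 → Polynomial ℂ) i).coeff k) = ![0, 0, 0, 1] := by
        funext i; fin_cases i <;> simp [hY', hS']
      rw [this]; exact he)
  obtain ⟨t', ht'⟩ := hA t
  refine ⟨fun i => (Y i).eval t, S.eval t, t', hne t, ?_, ht'⟩
  rw [← ht]
  congr 1
  funext i; fin_cases i <;> simp

theorem cayley_three (A : Matrix (Fin 3) (Fin 3) ℂ) (w : Fin 3 → ℂ) : ∃ α β γ : ℂ,
    A.mulVec (A.mulVec (A.mulVec w)) = α • A.mulVec (A.mulVec w) + β • A.mulVec w + γ • w := by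
  refine ⟨A.trace, -(A 0 0 * A 1 1 - A 0 1 * A 1 0 + A 0 0 * A 2 2 - A 0 2 * A 2 0 + A 1 1 * A 2 2
    - A 1 2 * A 2 1), A.det, ?_⟩
  rw [Matrix.det_fin_three, Matrix.trace_fin_three]
  funext i
  fin_cases i <;>
  simp only [Matrix.mulVec, dotProduct, Fin.sum_univ_three, Pi.add_apply, Pi.smul_apply, smul_eq_mul,
    Fin.zero_eta, Fin.mk_one, Fin.reduceFinMk] <;> ring

theorem krylov (A : Matrix (Fin 3) (Fin 3) ℂ) (w : Fin 3 → ℂ) (f : (Fin 4 → ℂ) → ℂ) (hf : IsQ f)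
    (he : f ![0, 0, 0, 1] ≠ 0) :
    ∃ (y : Fin 3 → ℂ) (s t : ℂ), y ≠ 0 ∧ f ![y 0, y 1, y 2, s] = 0 ∧ A.mulVec y + s • w = t • y := by
  by_cases h0 : ∃ v : Fin 3 → ℂ, v ≠ 0 ∧ (∃ l : ℂ, A.mulVec v = l • v) ∧ (∃ m : ℂ, w = m • v)
  · obtain ⟨v, hv, ⟨l, hl⟩, m, hm⟩ := h0
    refine krylov_aux A w f hf he 1 le_rfl (fun i => Polynomial.C (v i)) Polynomial.X ?_ ?_ ?_ ?_ ?_ ?_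
    · intro i; simp
    · intro i; simp [Polynomial.coeff_C]
    · simp
    · simp
    · intro t; simpa using hv
    · intro t
      refine ⟨l + t * m, ?_⟩
      simp only [Polynomial.eval_C, Polynomial.eval_X]
      rw [hl, hm]
      module
  have hw : w ≠ 0 := by
    rintro rfl
    apply h0
    obtain ⟨l, hl⟩ := Module.End.exists_eigenvalue (Matrix.toLin' A)
    obtain ⟨v, hv⟩ := hl.exists_hasEigenvector
    refine ⟨v, hv.2, ⟨l, ?_⟩, 0, by simp⟩
    simpa using hv.apply_eq_smul
  have h1 : ∀ l : ℂ, A.mulVec w ≠ l • w := fun l hl => h0 ⟨w, hw, ⟨l, hl⟩, 1, by simp⟩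
  by_cases h2 : ∃ α β : ℂ, A.mulVec (A.mulVec w) = α • A.mulVec w + β • w
  · obtain ⟨α, β, hαβ⟩ := h2
    refine krylov_aux A w f hf he 2 one_le_two
      (fun i => Polynomial.C (A.mulVec w i) + (Polynomial.X - Polynomial.C α) * Polynomial.C (w i))
      (Polynomial.X ^ 2 - Polynomial.C α * Polynomial.X - Polynomial.C β) ?_ ?_ ?_ ?_ ?_ ?_
    · intro i; compute_degree; norm_num
    · intro i; simp [Polynomial.coeff_C, Polynomial.coeff_X]
    · compute_degree
    · simp [Polynomial.coeff_C, Polynomial.coeff_X]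
    · intro t ht
      apply h1 (α - t)
      funext i
      have := congrFun ht i
      simp at this ⊢
      linear_combination this
    · intro t
      refine ⟨t, ?_⟩
      have : (fun i => (Polynomial.C (A.mulVec w i) +
        (Polynomial.X - Polynomial.C α) * Polynomial.C (w i)).eval t) =
        A.mulVec w + (t - α) • w := by funext i; simp
      rw [this, Matrix.mulVec_add, Matrix.mulVec_smul, hαβ]
      simp only [Polynomial.eval_sub, Polynomial.eval_pow, Polynomial.eval_mul, Polynomial.eval_C,
        Polynomial.eval_X]
      module
  · obtain ⟨α, β, γ, hαβ⟩ := cayley_three A w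
    refine krylov_aux A w f hf he 3 (by norm_num)
      (fun i => Polynomial.C (A.mulVec (A.mulVec w) i)
        + (Polynomial.X - Polynomial.C α) * Polynomial.C (A.mulVec w i)
        + (Polynomial.X ^ 2 - Polynomial.C α * Polynomial.X - Polynomial.C β) * Polynomial.C (w i))
      (Polynomial.X ^ 3 - Polynomial.C α * Polynomial.X ^ 2 - Polynomial.C β * Polynomial.X
        - Polynomial.C γ) ?_ ?_ ?_ ?_ ?_ ?_
    · intro i; compute_degree; norm_num
    · intro i; simp [Polynomial.coeff_C, Polynomial.coeff_X, Polynomial.coeff_X_pow]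
    · compute_degree
    · simp [Polynomial.coeff_C, Polynomial.coeff_X, Polynomial.coeff_X_pow]
    · intro t ht
      apply h2
      refine ⟨-(t - α), -(t ^ 2 - α * t - β), ?_⟩
      funext i
      have := congrFun ht i
      simp at this ⊢
      linear_combination this
    · intro t
      refine ⟨t, ?_⟩
      have : (fun i => (Polynomial.C (A.mulVec (A.mulVec w) i)
        + (Polynomial.X - Polynomial.C α) * Polynomial.C (A.mulVec w i)
        + (Polynomial.X ^ 2 - Polynomial.C α * Polynomial.X - Polynomial.C β)
          * Polynomial.C (w i)).eval t) =
        A.mulVec (A.mulVec w) + (t - α) • A.mulVec w + (t ^ 2 - α * t - β) • w := by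
        funext i; simp
      rw [this, Matrix.mulVec_add, Matrix.mulVec_add, Matrix.mulVec_smul, Matrix.mulVec_smul, hαβ]
      simp only [Polynomial.eval_sub, Polynomial.eval_pow, Polynomial.eval_mul, Polynomial.eval_C,
        Polynomial.eval_X]
      module

theorem case_one (q : Fin 4 → (Fin 4 → ℂ) → ℂ) (hq : ∀ k, IsQ (q k)) (h : ∀ y, q 0 y = 0) :
    ∃ x : Fin 4 → ℂ, x ≠ 0 ∧ ∀ k, q k x = 0 := by
  choose p hp using fun k => (hq k).poly
  obtain ⟨x, hx, hx0⟩ := exists_common_zero (fun i => p i.succ) (fun i => by rw [hp, (hq _).zero])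
  refine ⟨x, hx, fun k => ?_⟩
  refine Fin.cases (h x) (fun i => ?_) k
  rw [← hp]; exact hx0 i

theorem case_two (q : Fin 4 → (Fin 4 → ℂ) → ℂ) (hq : ∀ k, IsQ (q k))
    (h : ∀ y, y 0 * q 0 y + y 1 * q 1 y = 0) :
    ∃ x : Fin 4 → ℂ, x ≠ 0 ∧ ∀ k, q k x = 0 := by
  choose p hp using fun k => (hq k).poly
  obtain ⟨B, sB, hB⟩ := (hq 0).symm_form
  obtain ⟨D, sD, hD⟩ := (hq 1).symm_form
  have cyc := cyc_of_cubic_zero ![B, D, 0, 0] (by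
    intro i j k; fin_cases i <;> simp [sB j k, sD j k]) (by
    intro y
    have := h y
    rw [hB, hD, Finset.mul_sum, Finset.mul_sum] at this
    simp only [Finset.mul_sum] at this
    rw [← this, Fin.sum_univ_four]
    simp only [Matrix.cons_val_zero, Matrix.cons_val_one, Matrix.cons_val]
    simp only [Pi.zero_apply, zero_mul, Finset.sum_const_zero, add_zero]
    congr 1 <;>
    exact Finset.sum_congr rfl fun j _ => Finset.sum_congr rfl fun k _ => by ring)
  let c : MvPolynomial (Fin 4) ℂ := C (B 1 1) * X 1 + C (2 * B 0 1) * X 0 + C (2 * B 1 2) * X 2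
    + C (2 * B 1 3) * X 3
  have h0 : ∀ y, q 0 y = y 1 * eval y c := by
    intro y
    have e1 := cyc 0 0 0
    have e2 := cyc 0 0 2
    have e3 := cyc 0 0 3
    have e4 := cyc 0 2 2
    have e5 := cyc 0 2 3
    have e6 := cyc 0 3 3
    simp at e1 e2 e3 e4 e5 e6
    rw [hB]
    simp only [Fin.sum_univ_four, c, map_add, map_mul, eval_C, eval_X, sB 1 0, sB 2 0, sB 3 0, sB 2 1,
      sB 3 1, sB 3 2]
    simp only [sB 2 0, sB 3 0, sB 3 2] at e2 e3 e5
    grind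
  have h1 : ∀ y, q 1 y = - y 0 * eval y c := by
    intro y
    have e1 := cyc 1 1 1
    have e2 := cyc 1 1 2
    have e3 := cyc 1 1 3
    have e4 := cyc 1 2 2
    have e5 := cyc 1 2 3
    have e6 := cyc 1 3 3
    have e7 := cyc 0 0 1
    have e8 := cyc 0 1 1
    have e9 := cyc 0 1 2
    have e10 := cyc 0 1 3
    simp at e1 e2 e3 e4 e5 e6 e7 e8 e9 e10
    rw [hD]
    simp only [Fin.sum_univ_four, c, map_add, map_mul, eval_C, eval_X, sD 1 0, sD 2 0, sD 3 0, sD 2 1,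
      sD 3 1, sD 3 2]
    simp only [sD 1 0, sD 2 0, sD 3 0, sD 2 1, sD 3 1, sD 3 2, sB 1 0, sB 2 0, sB 3 0, sB 2 1,
      sB 3 1, sB 3 2] at e2 e3 e5 e7 e8 e9 e10
    grind
  obtain ⟨x, hx, hx0⟩ := exists_common_zero ![c, p 2, p 3] (by
    intro i; fin_cases i
    · simp [c]
    · show eval 0 (p 2) = 0
      rw [hp, (hq _).zero]
    · show eval 0 (p 3) = 0
      rw [hp, (hq _).zero])
  have z0 := hx0 0
  have z1 := hx0 1
  have z2 := hx0 2
  simp [hp] at z0 z1 z2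
  refine ⟨x, hx, fun k => ?_⟩
  fin_cases k
  · simp [h0, z0]
  · simp [h1, z0]
  · exact z1
  · exact z2

theorem case_three (q : Fin 4 → (Fin 4 → ℂ) → ℂ) (hq : ∀ k, IsQ (q k))
    (h : ∀ y, y 0 * q 0 y + y 1 * q 1 y + y 2 * q 2 y = 0) :
    ∃ x : Fin 4 → ℂ, x ≠ 0 ∧ ∀ k, q k x = 0 := by
  obtain ⟨B, sB, hB⟩ := (hq 0).symm_form
  obtain ⟨D, sD, hD⟩ := (hq 1).symm_form
  obtain ⟨E, sE, hE⟩ := (hq 2).symm_form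
  have cyc := cyc_of_cubic_zero ![B, D, E, 0] (by
    intro i j k; fin_cases i <;> simp [sB j k, sD j k, sE j k]) (by
    intro y
    have := h y
    rw [hB, hD, hE, Finset.mul_sum, Finset.mul_sum, Finset.mul_sum] at this
    simp only [Finset.mul_sum] at this
    rw [← this, Fin.sum_univ_four]
    simp only [Matrix.cons_val_zero, Matrix.cons_val_one, Matrix.cons_val]
    simp only [Pi.zero_apply, zero_mul, Finset.sum_const_zero, add_zero]
    congr 1
    · congr 1 <;>
      exact Finset.sum_congr rfl fun j _ => Finset.sum_congr rfl fun k _ => by ring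
    · exact Finset.sum_congr rfl fun j _ => Finset.sum_congr rfl fun k _ => by ring)
  have c000 := cyc 0 0 0
  have c111 := cyc 1 1 1
  have c222 := cyc 2 2 2
  have c001 := cyc 0 0 1
  have c002 := cyc 0 0 2
  have c003 := cyc 0 0 3
  have c011 := cyc 0 1 1
  have c012 := cyc 0 1 2
  have c013 := cyc 0 1 3
  have c022 := cyc 0 2 2
  have c023 := cyc 0 2 3
  have c033 := cyc 0 3 3
  have c112 := cyc 1 1 2
  have c113 := cyc 1 1 3
  have c122 := cyc 1 2 2
  have c123 := cyc 1 2 3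
  have c133 := cyc 1 3 3
  have c223 := cyc 2 2 3
  have c233 := cyc 2 3 3
  simp only [Matrix.cons_val_zero, Matrix.cons_val_one, Matrix.cons_val, Pi.zero_apply,
    sB 1 0, sB 2 0, sB 3 0, sB 2 1, sB 3 1, sB 3 2, sD 1 0, sD 2 0, sD 3 0, sD 2 1, sD 3 1, sD 3 2,
    sE 1 0, sE 2 0, sE 3 0, sE 2 1, sE 3 1, sE 3 2] at c000 c111 c222 c001 c002 c003 c011 c012 c013 c022 c023 c033 c112 c113 c122 c123 c133 c223 c233
  let A : Matrix (Fin 3) (Fin 3) ℂ := !![-2 * D 0 2, -2 * D 1 2, - D 2 2; 2 * B 0 2, 2 * B 1 2, B 2 2;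
    -2 * B 0 1, - B 1 1, 0]
  let w : Fin 3 → ℂ := ![-2 * D 2 3, 2 * B 2 3, -2 * B 1 3]
  have h0 : ∀ (y : Fin 3 → ℂ) (s : ℂ), q 0 ![y 0, y 1, y 2, s] =
      (A.mulVec y + s • w) 1 * y 2 - (A.mulVec y + s • w) 2 * y 1 := by
    intro y s
    rw [hB]
    simp only [Fin.sum_univ_four, sB 1 0, sB 2 0, sB 3 0, sB 2 1, sB 3 1, sB 3 2,
      Matrix.mulVec, dotProduct, Fin.sum_univ_three, A, w, Pi.add_apply, Pi.smul_apply, smul_eq_mul,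
      Matrix.of_apply, Matrix.cons_val_zero, Matrix.cons_val_one, Matrix.cons_val]
    grind
  have h1 : ∀ (y : Fin 3 → ℂ) (s : ℂ), q 1 ![y 0, y 1, y 2, s] =
      (A.mulVec y + s • w) 2 * y 0 - (A.mulVec y + s • w) 0 * y 2 := by
    intro y s
    rw [hD]
    simp only [Fin.sum_univ_four, sD 1 0, sD 2 0, sD 3 0, sD 2 1, sD 3 1, sD 3 2,
      Matrix.mulVec, dotProduct, Fin.sum_univ_three, A, w, Pi.add_apply, Pi.smul_apply, smul_eq_mul,
      Matrix.of_apply, Matrix.cons_val_zero, Matrix.cons_val_one, Matrix.cons_val]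
    grind
  have h2 : ∀ (y : Fin 3 → ℂ) (s : ℂ), q 2 ![y 0, y 1, y 2, s] =
      (A.mulVec y + s • w) 0 * y 1 - (A.mulVec y + s • w) 1 * y 0 := by
    intro y s
    rw [hE]
    simp only [Fin.sum_univ_four, sE 1 0, sE 2 0, sE 3 0, sE 2 1, sE 3 1, sE 3 2,
      Matrix.mulVec, dotProduct, Fin.sum_univ_three, A, w, Pi.add_apply, Pi.smul_apply, smul_eq_mul,
      Matrix.of_apply, Matrix.cons_val_zero, Matrix.cons_val_one, Matrix.cons_val]
    grind
  by_cases he : q 3 ![0, 0, 0, 1] = 0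
  · refine ⟨![0, 0, 0, 1], ?_, ?_⟩
    · intro hh
      have := congrFun hh 3
      simp at this
    · have g0 := h0 0 1
      have g1 := h1 0 1
      have g2 := h2 0 1
      simp only [Pi.zero_apply, mul_zero, sub_zero] at g0 g1 g2
      intro k
      fin_cases k
      · exact g0
      · exact g1
      · exact g2
      · exact he
  · obtain ⟨y, s, t, hy, hf, hv⟩ := krylov A w (q 3) (hq 3) he
    refine ⟨![y 0, y 1, y 2, s], ?_, ?_⟩
    · intro hh
      apply hy
      have e0 := congrFun hh 0
      have e1 := congrFun hh 1
      have e2 := congrFun hh 2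
      simp at e0 e1 e2
      funext i
      fin_cases i <;> simp [e0, e1, e2]
    · intro k
      fin_cases k
      · show q 0 _ = 0
        rw [h0, hv]; simp only [Pi.smul_apply, smul_eq_mul]; ring
      · show q 1 _ = 0
        rw [h1, hv]; simp only [Pi.smul_apply, smul_eq_mul]; ring
      · show q 2 _ = 0
        rw [h2, hv]; simp only [Pi.smul_apply, smul_eq_mul]; ring
      · exact hf

theorem perm_pattern : ∀ b : Fin 4 → Bool, (∃ k, b k = true) → (∃ k, b k = false) →
    ∃ e : Equiv.Perm (Fin 4), b (e 0) = true ∧ b (e 3) = false ∧ (b (e 2) = true → b (e 1) = true) := by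
  decide +kernel

theorem IsQ.comp_fun {n m : ℕ} {f : (Fin n → ℂ) → ℂ} (h : IsQ f) (e : Fin n → Fin m) :
    IsQ (fun x => f (fun i => x (e i))) := by
  have := h.comp_mulVec (m := m) (fun i j => if j = e i then 1 else 0)
  convert this using 3 with x
  funext i
  simp [Matrix.mulVec, dotProduct]

theorem IsQ.smul {n : ℕ} {f : (Fin n → ℂ) → ℂ} (h : IsQ f) (c : ℂ) :
    IsQ (fun x => c * f x) := by
  have := IsQ.sum_smul (m := 1) (f := fun _ => f) (fun _ => h) (fun _ => c)
  simpa using this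

theorem IsQ.eq_zero_of_mul {f : (Fin 4 → ℂ) → ℂ} (h : IsQ f) (hh : ∀ y, y 0 * f y = 0) (y : Fin 4 → ℂ) :
    f y = 0 := by
  obtain ⟨p, hp⟩ := h.poly
  have : X 0 * p = 0 := by
    apply MvPolynomial.funext
    intro x
    simp [hp, hh]
  have : p = 0 := by
    rcases mul_eq_zero.1 this with h | h
    · exact absurd h (X_ne_zero 0)
    · exact h
  rw [← hp, this]; simp

theorem diag_syz (q : Fin 4 → (Fin 4 → ℂ) → ℂ) (hq : ∀ k, IsQ (q k)) (d : Fin 4 → ℂ) (h1 : ∃ k, d k ≠ 0)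
    (h2 : ∃ k, d k = 0) (h : ∀ x : Fin 4 → ℂ, ∑ k, d k * x k * q k x = 0) :
    ∃ x : Fin 4 → ℂ, x ≠ 0 ∧ ∀ k, q k x = 0 := by
  classical
  obtain ⟨e, he0, he3, he21⟩ := perm_pattern (fun k => decide (d k ≠ 0))
    (by simpa using h1) (by simpa using h2)
  simp only [decide_eq_true_eq, decide_eq_false_iff_not, not_not] at he0 he3 he21
  let Q : Fin 4 → (Fin 4 → ℂ) → ℂ := fun k y =>
    (if d (e k) ≠ 0 then d (e k) else 1) * q (e k) (fun i => y (e.symm i))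
  have hQ : ∀ k, IsQ (Q k) := fun k => ((hq (e k)).comp_fun e.symm).smul _
  have hQs : ∀ y : Fin 4 → ℂ, ∑ k, (if d (e k) ≠ 0 then y k * Q k y else 0) = 0 := by
    intro y
    refine Eq.trans ?_ (h (fun i => y (e.symm i)))
    rw [← Equiv.sum_comp e (fun k => d k * y (e.symm k) * q k (fun i => y (e.symm i)))]
    refine Finset.sum_congr rfl fun k _ => ?_
    simp only [Q, Equiv.symm_apply_apply]
    split_ifs with hk
    · ring
    · push Not at hk
      rw [hk]; ring
  suffices ∃ x : Fin 4 → ℂ, x ≠ 0 ∧ ∀ k, Q k x = 0 by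
    obtain ⟨x, hx, hx0⟩ := this
    refine ⟨fun i => x (e.symm i), ?_, fun k => ?_⟩
    · intro hh
      apply hx
      funext i
      have := congrFun hh (e i)
      simpa using this
    · have := hx0 (e.symm k)
      simp only [Q, Equiv.apply_symm_apply] at this
      rcases mul_eq_zero.1 this with h | h
      · split_ifs at h with hk
        · exact absurd h hk
        · exact absurd h one_ne_zero
      · exact h
  simp only [Fin.sum_univ_four, if_pos he0, he3, ne_eq, not_true_eq_false, if_false, add_zero] at hQs
  by_cases h2 : d (e 2) = 0
  · simp only [h2, not_true_eq_false, if_false, add_zero] at hQs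
    by_cases h1 : d (e 1) = 0
    · simp only [h1, not_true_eq_false, if_false, add_zero, he0, not_false_eq_true, if_true] at hQs
      exact case_one Q hQ ((hQ 0).eq_zero_of_mul hQs)
    · simp only [h1, not_false_eq_true, if_true, he0] at hQs
      exact case_two Q hQ hQs
  · have h1 := he21 h2
    simp only [h1, h2, not_false_eq_true, if_true, ne_eq, he0] at hQs
    exact case_three Q hQ hQs

theorem singular_syz (q : Fin 4 → (Fin 4 → ℂ) → ℂ) (hq : ∀ k, IsQ (q k)) (L : Matrix (Fin 4) (Fin 4) ℂ)
    (hL : L ≠ 0) (hdet : L.det = 0)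
    (h : ∀ x : Fin 4 → ℂ, ∑ k, L.mulVec x k * q k x = 0) :
    ∃ x : Fin 4 → ℂ, x ≠ 0 ∧ ∀ k, q k x = 0 := by
  obtain ⟨l, l', d, hd⟩ := Matrix.Pivot.exists_list_transvec_mul_diagonal_mul_list_transvec L
  set P := (l.map Matrix.TransvectionStruct.toMatrix).prod with hP
  set R := (l'.map Matrix.TransvectionStruct.toMatrix).prod with hR
  have dP : P.det = 1 := Matrix.TransvectionStruct.det_toMatrix_prod l
  have dR : R.det = 1 := Matrix.TransvectionStruct.det_toMatrix_prod l'
  have uR : IsUnit R.det := by rw [dR]; exact isUnit_one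
  have uP : IsUnit P.det := by rw [dP]; exact isUnit_one
  have h1 : ∃ k, d k ≠ 0 := by
    by_contra hc
    push Not at hc
    apply hL
    rw [hd, show d = 0 from funext hc]
    simp
  have h2 : ∃ k, d k = 0 := by
    rw [hd, Matrix.det_mul, Matrix.det_mul, dP, dR, Matrix.det_diagonal] at hdet
    simpa [Finset.prod_eq_zero_iff] using hdet
  obtain ⟨y, hy, hy0⟩ := diag_syz (fun k y => ∑ j, P j k * q j (R⁻¹.mulVec y))
    (fun k => IsQ.sum_smul (fun j => (hq j).comp_mulVec _) _) d h1 h2 (by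
      intro y
      rw [← h (R⁻¹.mulVec y), Matrix.mulVec_mulVec, hd, Matrix.mul_assoc, Matrix.mul_nonsing_inv _ uR,
        Matrix.mul_one, ← Matrix.mulVec_mulVec]
      have : ∀ k, (Matrix.diagonal d).mulVec y k = d k * y k := fun k => Matrix.mulVec_diagonal d y k
      simp only [Matrix.mulVec, dotProduct] at this ⊢
      simp only [this, Finset.mul_sum, Finset.sum_mul]
      rw [Finset.sum_comm]
      refine Finset.sum_congr rfl fun i _ => Finset.sum_congr rfl fun j _ => by ring)
  refine ⟨R⁻¹.mulVec y, ?_, ?_⟩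
  · intro hh
    apply hy
    have := congrArg R.mulVec hh
    rwa [Matrix.mulVec_mulVec, Matrix.mul_nonsing_inv _ uR, Matrix.one_mulVec, Matrix.mulVec_zero] at this
  · have hz : P.transpose.mulVec (fun j => q j (R⁻¹.mulVec y)) = 0 := by
      funext k
      exact hy0 k
    have : (fun j => q j (R⁻¹.mulVec y)) = 0 := by
      apply Matrix.eq_zero_of_mulVec_eq_zero _ hz
      rw [Matrix.det_transpose, dP]; exact one_ne_zero
    exact fun k => congrFun this k

/-- A pencil of matrices contains a singular member. -/
theorem pencil (L₁ L₂ : Matrix (Fin 4) (Fin 4) ℂ) (h : LinearIndependent ℂ ![L₁, L₂]) :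
    ∃ a b : ℂ, a • L₁ + b • L₂ ≠ 0 ∧ (a • L₁ + b • L₂).det = 0 := by
  rw [LinearIndependent.pair_iff] at h
  by_cases h2 : L₂.det = 0
  · refine ⟨0, 1, fun hh => one_ne_zero (h 0 1 hh).2, by simpa using h2⟩
  · obtain ⟨l, hl⟩ := Module.End.exists_eigenvalue (Matrix.toLin' (L₂⁻¹ * L₁))
    obtain ⟨v, hv⟩ := hl.exists_hasEigenvector
    have e := hv.apply_eq_smul
    have uL : IsUnit L₂.det := isUnit_iff_ne_zero.2 h2
    refine ⟨1, -l, fun hh => one_ne_zero (h 1 (-l) hh).1, ?_⟩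
    rw [← Matrix.exists_mulVec_eq_zero_iff]
    refine ⟨v, hv.2, ?_⟩
    rw [Matrix.toLin'_apply] at e
    have e' := congrArg L₂.mulVec e
    rw [Matrix.mulVec_mulVec, ← Matrix.mul_assoc, Matrix.mul_nonsing_inv _ uL, Matrix.one_mul,
      Matrix.mulVec_smul] at e'
    rw [Matrix.add_mulVec, Matrix.smul_mulVec, Matrix.smul_mulVec, e']
    module

theorem syz_dim (q : Fin 4 → (Fin 4 → ℂ) → ℂ) (hq : ∀ k, IsQ (q k))
    (hz : ∀ x : Fin 4 → ℂ, (∀ k, q k x = 0) → x = 0)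
    (K : Submodule ℂ (Fin 4 → Fin 4 → ℂ))
    (hK : ∀ m ∈ K, ∀ x : Fin 4 → ℂ, ∑ k, (∑ i, m k i * x i) * q k x = 0) :
    Module.finrank ℂ K < 2 := by
  by_contra hc
  push Not at hc
  obtain ⟨f, hf⟩ := exists_linearIndependent_of_le_finrank hc
  let M₀ : Matrix (Fin 4) (Fin 4) ℂ := (f 0).1
  let M₁ : Matrix (Fin 4) (Fin 4) ℂ := (f 1).1
  have hf2 : LinearIndependent ℂ ![M₀, M₁] := by
    have := hf.map' K.subtype (Submodule.ker_subtype K)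
    have e : (![(f 0).1, (f 1).1] : Fin 2 → (Fin 4 → Fin 4 → ℂ)) = K.subtype ∘ f := by
      funext i; fin_cases i <;> rfl
    rw [← e] at this
    exact this
  obtain ⟨a, b, hne, hdet⟩ := pencil _ _ hf2
  obtain ⟨x, hx, hx0⟩ := singular_syz q hq _ hne hdet (fun x =>
    hK _ (K.add_mem (K.smul_mem a (f 0).2) (K.smul_mem b (f 1).2)) x)
  exact hx (hz x hx0)

theorem IsQ.smul_arg {n : ℕ} {f : (Fin n → ℂ) → ℂ} (h : IsQ f) (c : ℂ) (x : Fin n → ℂ) :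
    f (c • x) = c ^ 2 * f x := by
  obtain ⟨B, hB⟩ := h
  simp only [hB, Finset.mul_sum, Pi.smul_apply, smul_eq_mul]
  exact Finset.sum_congr rfl fun i _ => Finset.sum_congr rfl fun j _ => by ring

theorem choose_four (q : Fin 5 → (Fin 4 → ℂ) → ℂ) (hq : ∀ k, IsQ (q k))
    (hz : ∀ x : Fin 4 → ℂ, (∀ k, q k x = 0) → x = 0) :
    ∃ N : Fin 4 → Fin 5 → ℂ, ∀ x : Fin 4 → ℂ, (∀ k, ∑ i, N k i * q i x = 0) → x = 0 := by
  let f : (Fin 4 → ℂ) → (Fin 5 → ℂ) := fun x k => q k x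
  have hf : ContDiff ℝ 1 f := by
    rw [contDiff_pi]
    intro k
    obtain ⟨B, hB⟩ := hq k
    have : (fun x => f x k) = fun x => ∑ i, ∑ j, B i j * x i * x j := by
      funext x; exact hB x
    rw [this]
    fun_prop
  have hd : Dense (Set.range f)ᶜ := hf.dense_compl_range_of_finrank_lt_finrank (by
    simp [Module.finrank_pi_fintype])
  obtain ⟨u, hu⟩ := hd.nonempty
  have hu0 : u ≠ 0 := by
    rintro rfl
    apply hu
    exact ⟨0, funext fun k => (hq k).zero⟩
  let U := Submodule.span ℂ {u}
  have hr : Module.finrank ℂ ((Fin 5 → ℂ) ⧸ U) = Module.finrank ℂ (Fin 4 → ℂ) := by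
    have h1 := U.finrank_quotient_add_finrank
    have h2 : Module.finrank ℂ U = 1 := finrank_span_singleton hu0
    simp at h1 ⊢
    omega
  let g : (Fin 5 → ℂ) →ₗ[ℂ] (Fin 4 → ℂ) := (LinearEquiv.ofFinrankEq _ _ hr).toLinearMap ∘ₗ U.mkQ
  refine ⟨LinearMap.toMatrix' g, fun x hx => ?_⟩
  have hg : g (f x) = 0 := by
    rw [← LinearMap.toMatrix'_mulVec]
    funext k
    exact hx k
  have hm : f x ∈ U := by
    simpa [g] using hg
  obtain ⟨c, hc⟩ := Submodule.mem_span_singleton.1 hm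
  by_cases hc0 : c = 0
  · apply hz
    intro k
    have := congrFun hc k
    rw [hc0] at this
    simpa [f] using this.symm
  · exfalso
    obtain ⟨s, hs⟩ := IsAlgClosed.exists_pow_nat_eq (c⁻¹) (n := 2) (by norm_num)
    apply hu
    refine ⟨s • x, ?_⟩
    funext k
    show q k (s • x) = u k
    rw [(hq k).smul_arg, hs]
    have := congrFun hc k
    simp only [Pi.smul_apply, smul_eq_mul] at this
    change c * u k = q k x at this
    rw [← this]
    field_simp

theorem isQ_of_homog {n : ℕ} {w : MvPolynomial (Fin n) ℂ} (hw : w.IsHomogeneous 2) :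
    IsQ (fun x => eval x w) := by
  have h1 : ∀ i, (pderiv i w).IsHomogeneous 1 := fun i => hw.pderiv
  have h2 : ∀ i j, (pderiv j (pderiv i w)).IsHomogeneous 0 := fun i j => (h1 i).pderiv
  have h3 : ∀ i j, pderiv j (pderiv i w) = C (coeff 0 (pderiv j (pderiv i w))) := fun i j => by
    rw [← totalDegree_eq_zero_iff_eq_C]
    exact Nat.le_zero.1 (h2 i j).totalDegree_le
  refine ⟨fun i j => coeff 0 (pderiv j (pderiv i w)) / 2, fun x => ?_⟩
  have e2 := congrArg (eval x) hw.sum_X_mul_pderiv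
  have e1 := fun i => congrArg (eval x) (h1 i).sum_X_mul_pderiv
  simp only [map_sum, map_mul, eval_X, nsmul_eq_mul, map_natCast] at e2 e1
  have e0 : ∀ i j, eval x (pderiv j (pderiv i w)) = coeff 0 (pderiv j (pderiv i w)) := by
    intro i j
    conv_lhs => rw [h3 i j]
    simp
  simp only [e0] at e1
  have e3 : ∀ i, eval x (pderiv i w) = ∑ j, x j * coeff 0 (pderiv j (pderiv i w)) := by
    intro i; rw [e1]; simp
  simp only [e3, Finset.mul_sum] at e2
  beta_reduce
  have : eval x w = (1/2 : ℂ) * (((2:ℕ) : ℂ) * eval x w) := by push_cast; ring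
  rw [this, ← e2, Finset.mul_sum]
  refine Finset.sum_congr rfl fun i _ => ?_
  rw [Finset.mul_sum]
  refine Finset.sum_congr rfl fun j _ => ?_
  ring

theorem exists_det_ne_zero {n : ℕ} (M : Matrix (Fin n) (Fin n) ℂ) :
    ∃ t : ℂ, t ≠ 0 ∧ (1 + t • M).det ≠ 0 := by
  have hc : Continuous (fun t : ℂ => (1 + t • M).det) := by
    apply Continuous.matrix_det
    fun_prop
  have h0 : (1 + (0:ℂ) • M).det ≠ 0 := by simp
  have h1 : ∀ᶠ t in nhds (0:ℂ), (1 + t • M).det ≠ 0 := hc.continuousAt.eventually_ne h0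
  have h2 : ∀ᶠ t in nhdsWithin (0:ℂ) {0}ᶜ, (1 + t • M).det ≠ 0 := h1.filter_mono nhdsWithin_le_nhds
  have h3 : ∀ᶠ t in nhdsWithin (0:ℂ) {0}ᶜ, t ≠ 0 := eventually_mem_nhdsWithin
  obtain ⟨t, h⟩ := (h3.and h2).exists
  exact ⟨t, h⟩

theorem exists_dual {W : Type*} [AddCommGroup W] [Module ℂ W] {n : ℕ} {x : Fin n → W}
    (hx : LinearIndependent ℂ x) : ∃ φ : W →ₗ[ℂ] (Fin n → ℂ), ∀ i, φ (x i) = Pi.single i 1 := by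
  let b := Module.Basis.span hx
  obtain ⟨φ, hφ⟩ := LinearMap.exists_extend (b.constr ℂ (fun i => (Pi.single i 1 : Fin n → ℂ)))
  refine ⟨φ, fun i => ?_⟩
  have h1 : ((b i : Submodule.span ℂ (Set.range x)) : W) = x i := by
    simp [b, Module.Basis.span_apply]
  have h2 := LinearMap.congr_fun hφ (b i)
  rw [Module.Basis.constr_basis] at h2
  rw [← h2, ← h1]
  rfl

theorem linInd_of_det {W : Type*} [AddCommGroup W] [Module ℂ W] {n : ℕ} {x : Fin n → W}
    (φ : W →ₗ[ℂ] (Fin n → ℂ)) (h : (Matrix.of fun i => φ (x i)).det ≠ 0) : LinearIndependent ℂ x := by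
  apply LinearIndependent.of_comp φ
  exact Matrix.linearIndependent_rows_of_det_ne_zero h

theorem linInd_perturb {W : Type*} [AddCommGroup W] [Module ℂ W] {n : ℕ} {x : Fin n → W}
    (hx : LinearIndependent ℂ x) (y : Fin n → W) :
    ∃ t : ℂ, t ≠ 0 ∧ LinearIndependent ℂ (fun i => x i + t • y i) := by
  obtain ⟨φ, hφ⟩ := exists_dual hx
  obtain ⟨t, ht, hd⟩ := exists_det_ne_zero (Matrix.of fun i => φ (y i))
  refine ⟨t, ht, linInd_of_det φ ?_⟩
  convert hd using 2
  ext i j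
  simp [hφ, Matrix.one_apply, Pi.single_apply, eq_comm]

theorem tangent_aux {V W : Type*} [AddCommGroup W] [Module ℂ W] [AddCommGroup V] [Module ℂ V]
    [FiniteDimensional ℂ V] (μ₀ μ₁ : V →ₗ[ℂ] W) (a : V) (ha : μ₀ a = 0)
    (h : μ₁ a ∉ LinearMap.range μ₀) :
    ∃ t : ℂ, Module.finrank ℂ (LinearMap.range μ₀) < Module.finrank ℂ (LinearMap.range (μ₀ + t • μ₁)) := by
  let b := Module.finBasis ℂ (LinearMap.range μ₀)
  choose v hv using fun i => (b i).2
  have hb : LinearIndependent ℂ (fun i => μ₀ (v i)) := by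
    have := b.linearIndependent.map' (LinearMap.range μ₀).subtype (Submodule.ker_subtype _)
    have e : (fun i => μ₀ (v i)) = (LinearMap.range μ₀).subtype ∘ b := _root_.funext hv
    rw [e]
    exact this
  have hc : LinearIndependent ℂ (Fin.cons (μ₁ a) (fun i => μ₀ (v i)) : Fin (_ + 1) → W) := by
    rw [linearIndependent_finCons]
    refine ⟨hb, fun hh => h ?_⟩
    refine Submodule.span_le.2 ?_ hh
    rintro _ ⟨i, rfl⟩
    exact ⟨v i, rfl⟩
  obtain ⟨t, ht, hl⟩ := linInd_perturb hc (Fin.cons 0 (fun i => μ₁ (v i)))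
  refine ⟨t, ?_⟩
  let g : Fin (Module.finrank ℂ (LinearMap.range μ₀) + 1) → LinearMap.range (μ₀ + t • μ₁) :=
    fun i => ⟨(Fin.cons (μ₁ a) (fun i => μ₀ (v i)) : Fin (_ + 1) → W) i +
      t • (Fin.cons 0 (fun i => μ₁ (v i)) : Fin (_ + 1) → W) i, by
      refine Fin.cases ?_ (fun j => ?_) i
      · refine ⟨t⁻¹ • a, ?_⟩
        simp [ha, ht]
      · exact ⟨v j, by simp⟩⟩
  have hg : LinearIndependent ℂ g := by
    apply LinearIndependent.of_comp (LinearMap.range (μ₀ + t • μ₁)).subtype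
    exact hl
  have := hg.fintype_card_le_finrank
  simpa using this

theorem tangent {E V W : Type*} [AddCommGroup W] [Module ℂ W] [AddCommGroup V] [Module ℂ V]
    [FiniteDimensional ℂ V] [AddCommGroup E] [Module ℂ E] (μ : E →ₗ[ℂ] V →ₗ[ℂ] W)
    (h : ∀ e, ¬ Function.Injective (μ e)) :
    ∃ e a, a ≠ 0 ∧ μ e a = 0 ∧ ∀ e', ∃ m, μ e' a = μ e m := by
  have hbd : ∃ e, ∀ e', Module.finrank ℂ (LinearMap.range (μ e')) ≤ Module.finrank ℂ (LinearMap.range (μ e)) := by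
    by_contra hc
    push Not at hc
    have : ∀ n : ℕ, ∃ e, n ≤ Module.finrank ℂ (LinearMap.range (μ e)) := by
      intro n
      induction n with
      | zero => exact ⟨0, Nat.zero_le _⟩
      | succ n ih =>
        obtain ⟨e, he⟩ := ih
        obtain ⟨e', he'⟩ := hc e
        exact ⟨e', by omega⟩
    obtain ⟨e, he⟩ := this (Module.finrank ℂ V + 1)
    have := LinearMap.finrank_range_le (μ e)
    omega
  obtain ⟨e, he⟩ := hbd
  have h1 := h e
  rw [← LinearMap.ker_eq_bot, Submodule.eq_bot_iff] at h1
  push Not at h1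
  obtain ⟨a, ha, ha0⟩ := h1
  refine ⟨e, a, ha0, ha, fun e' => ?_⟩
  by_contra hc
  obtain ⟨t, ht⟩ := tangent_aux (μ e) (μ e') a ha (fun ⟨m, hm⟩ => hc ⟨m, hm.symm⟩)
  have := he (e + t • e')
  rw [map_add, map_smul] at this
  omega

/-- linear forms -/
noncomputable def linF (n : ℕ) : (Fin n → ℂ) →ₗ[ℂ] MvPolynomial (Fin n) ℂ where
  toFun a := ∑ i, C (a i) * X i
  map_add' a b := by simp [add_mul, Finset.sum_add_distrib]
  map_smul' c a := by
    simp only [Pi.smul_apply, smul_eq_mul, C_mul, RingHom.id_apply, Finset.smul_sum, smul_eq_C_mul, mul_assoc]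

/-- quadratic forms -/
noncomputable def quadF (n : ℕ) : (Fin n → Fin n → ℂ) →ₗ[ℂ] MvPolynomial (Fin n) ℂ where
  toFun B := ∑ i, ∑ j, C (B i j) * (X i * X j)
  map_add' a b := by simp [add_mul, Finset.sum_add_distrib]
  map_smul' c a := by
    simp only [Pi.smul_apply, smul_eq_mul, C_mul, RingHom.id_apply, Finset.smul_sum, smul_eq_C_mul, mul_assoc]

/-- linear combinations with linear coefficients -/
noncomputable def psiF {n r : ℕ} (w : Fin r → MvPolynomial (Fin n) ℂ) :
    (Fin r → Fin n → ℂ) →ₗ[ℂ] MvPolynomial (Fin n) ℂ where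
  toFun l := ∑ i, linF n (l i) * w i
  map_add' a b := by simp [add_mul, Finset.sum_add_distrib]
  map_smul' c a := by
    simp only [Pi.smul_apply, map_smul, RingHom.id_apply, Finset.smul_sum, smul_mul_assoc]

theorem linF_apply {n : ℕ} (a : Fin n → ℂ) : linF n a = ∑ i, C (a i) * X i := rfl
theorem quadF_apply {n : ℕ} (B : Fin n → Fin n → ℂ) : quadF n B = ∑ i, ∑ j, C (B i j) * (X i * X j) := rfl
theorem psiF_apply {n r : ℕ} (w : Fin r → MvPolynomial (Fin n) ℂ) (l : Fin r → Fin n → ℂ) :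
    psiF w l = ∑ i, linF n (l i) * w i := rfl

theorem linF_ne_zero {n : ℕ} {a : Fin n → ℂ} (ha : a ≠ 0) : linF n a ≠ 0 := by
  intro h
  apply ha
  funext i
  have := congrArg (eval (Pi.single i 1)) h
  simpa [linF_apply, Pi.single_apply] using this

theorem eval_linF {n : ℕ} (a x : Fin n → ℂ) : eval x (linF n a) = ∑ i, a i * x i := by
  simp [linF_apply]

/-- index pairs -/
abbrev Pr := {p : Fin 5 × Fin 5 // p.1 ≤ p.2}

theorem pr_inj : ∀ p q : Pr, (∀ k : Fin 5, (if p.1.1 = k then 1 else 0) + (if p.1.2 = k then 1 else 0) =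
    (if q.1.1 = k then 1 else 0) + (if q.1.2 = k then (1:ℕ) else 0)) → p = q := by
  decide +kernel

theorem finrank_quad (L : MvPolynomial (Fin 5) ℂ) (hL : L ≠ 0) :
    15 ≤ Module.finrank ℂ (LinearMap.range ((LinearMap.mulLeft ℂ L) ∘ₗ quadF 5)) := by
  have h1 : LinearIndependent ℂ (fun p : Pr => (X p.1.1 * X p.1.2 : MvPolynomial (Fin 5) ℂ)) := by
    have h := (basisMonomials (Fin 5) ℂ).linearIndependent.comp
      (fun p : Pr => Finsupp.single p.1.1 1 + Finsupp.single p.1.2 1) (by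
        intro p q hpq
        apply pr_inj
        intro k
        have := DFunLike.congr_fun hpq k
        simpa [Finsupp.single_apply] using this)
    have e : (fun p : Pr => (X p.1.1 * X p.1.2 : MvPolynomial (Fin 5) ℂ)) =
      ⇑(basisMonomials (Fin 5) ℂ) ∘ (fun p : Pr => Finsupp.single p.1.1 1 + Finsupp.single p.1.2 1) := by
      funext p
      simp [X, monomial_mul]
    rw [e]
    exact h
  have h2 : LinearIndependent ℂ (fun p : Pr => (L * (X p.1.1 * X p.1.2) : MvPolynomial (Fin 5) ℂ)) := by
    have := h1.map' (LinearMap.mulLeft ℂ L) (by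
      rw [LinearMap.ker_eq_bot]
      exact mul_right_injective₀ hL)
    exact this
  let g : Pr → LinearMap.range ((LinearMap.mulLeft ℂ L) ∘ₗ quadF 5) := fun p =>
    ⟨L * (X p.1.1 * X p.1.2), Pi.single p.1.1 (Pi.single p.1.2 1), by
      simp only [LinearMap.comp_apply, LinearMap.mulLeft_apply, quadF_apply]
      congr 1
      rw [Finset.sum_eq_single p.1.1, Finset.sum_eq_single p.1.2]
      · simp
      · intro j _ hj; simp [hj]
      · simp
      · intro i _ hi; simp [hi]
      · simp⟩
  have hg : LinearIndependent ℂ g := by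
    apply LinearIndependent.of_comp (Submodule.subtype _)
    exact h2
  have := hg.fintype_card_le_finrank
  have hc : Fintype.card Pr = 15 := by decide +kernel
  omega

theorem count (F : MvPolynomial (Fin 5) ℂ) (hF : F.IsHomogeneous 3)
    (hs : ∀ x : Fin 5 → ℂ, (∀ i, eval x (pderiv i F) = 0) → x = 0)
    (Q : MvPolynomial (Fin 5) ℂ) (a : Fin 5 → ℂ) (ha : a ≠ 0)
    (h1 : ∃ l, linF 5 a * Q = psiF (fun i => pderiv i F) l)
    (h2 : ∀ B, ∃ l m, linF 5 a * quadF 5 B = psiF (fun i => pderiv i F) l + linF 5 m * Q) : False := by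
  obtain ⟨j, hj⟩ : ∃ j, a j ≠ 0 := by
    by_contra hc
    push Not at hc
    exact ha (_root_.funext hc)
  -- the substitution
  let M : Matrix (Fin 5) (Fin 4) ℂ :=
    j.insertNth (α := fun _ => Fin 4 → ℂ) (fun k => - a (j.succAbove k) / a j) (fun k => Pi.single k 1)
  have Mj : ∀ k, M j k = - a (j.succAbove k) / a j := by intro k; simp [M]
  have Ms : ∀ i k, M (j.succAbove i) k = (Pi.single i 1 : Fin 4 → ℂ) k := by intro i k; simp [M]
  let σ : MvPolynomial (Fin 5) ℂ →ₐ[ℂ] MvPolynomial (Fin 4) ℂ := aeval (fun i => linF 4 (M i))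
  have hσe : ∀ x p, eval x (σ p) = eval (M.mulVec x) p := by
    intro x p
    have : (eval x).comp σ.toRingHom = eval (M.mulVec x) := by
      apply MvPolynomial.ringHom_ext
      · intro r; simp [σ]
      · intro i
        simp [σ, eval_linF, Matrix.mulVec, dotProduct]
    exact RingHom.congr_fun this p
  have hσa : σ (linF 5 a) = 0 := by
    apply MvPolynomial.funext
    intro x
    rw [hσe, eval_linF, Fin.sum_univ_succAbove _ j]
    simp only [Matrix.mulVec, dotProduct, Mj, Ms, Pi.single_apply, ite_mul, one_mul, zero_mul,
      Finset.sum_ite_eq', Finset.sum_ite_eq, Finset.mem_univ, if_true, map_zero, Finset.mul_sum]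
    rw [← Finset.sum_add_distrib]
    apply Finset.sum_eq_zero
    intro k _
    field_simp
    ring
  have hinj : ∀ x, M.mulVec x = 0 → x = 0 := by
    intro x hx
    funext k
    have := congrFun hx (j.succAbove k)
    simpa [Matrix.mulVec, dotProduct, Ms, Pi.single_apply] using this
  have hlift : ∀ m : Fin 4 → ℂ, σ (linF 5 (j.insertNth (α := fun _ => ℂ) 0 m)) = linF 4 m := by
    intro m
    apply MvPolynomial.funext
    intro x
    rw [hσe, eval_linF, eval_linF, Fin.sum_univ_succAbove _ j]
    simp [Matrix.mulVec, dotProduct, Ms, Pi.single_apply]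
  let f : Fin 5 → MvPolynomial (Fin 5) ℂ := fun i => pderiv i F
  have hfQ : ∀ i, IsQ (fun x => eval x (f i)) := fun i => isQ_of_homog hF.pderiv
  obtain ⟨N, hN⟩ := choose_four (fun i x => eval (M.mulVec x) (f i)) (fun i => (hfQ i).comp_mulVec M)
    (fun x hx => hinj x (hs _ hx))
  let w : Fin 4 → MvPolynomial (Fin 4) ℂ := fun k => ∑ i, C (N k i) * σ (f i)
  have hw : ∀ k x, eval x (w k) = ∑ i, N k i * eval (M.mulVec x) (f i) := by
    intro k x
    simp [w, hσe]
  -- the big map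
  let Φ : ((Fin 5 → Fin 5 → ℂ) × (Fin 5 → ℂ)) →ₗ[ℂ] MvPolynomial (Fin 5) ℂ :=
    (psiF f).coprod ((LinearMap.mulRight ℂ Q) ∘ₗ linF 5)
  have hΦ : ∀ l m, Φ (l, m) = psiF f l + linF 5 m * Q := by intro l m; simp [Φ]
  let T := LinearMap.range ((LinearMap.mulLeft ℂ (linF 5 a)) ∘ₗ quadF 5)
  have hT : 15 ≤ Module.finrank ℂ T := finrank_quad _ (linF_ne_zero ha)
  let K' := T.comap Φ
  have hK' : 16 ≤ Module.finrank ℂ K' := by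
    have r1 := (Φ.domRestrict K').finrank_range_add_finrank_ker
    have r2 : LinearMap.range (Φ.domRestrict K') = T := by
      apply le_antisymm
      · rintro _ ⟨⟨z, hz⟩, rfl⟩
        exact hz
      · rintro _ ⟨B, rfl⟩
        obtain ⟨l, m, hlm⟩ := h2 B
        have e : Φ (l, m) = linF 5 a * quadF 5 B := by rw [hΦ, hlm]
        refine ⟨⟨(l, m), ?_⟩, e⟩
        show Φ (l, m) ∈ T
        rw [e]
        exact ⟨B, rfl⟩
    have r3 : 0 < Module.finrank ℂ (LinearMap.ker (Φ.domRestrict K')) := by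
      obtain ⟨l, hl⟩ := h1
      have e : Φ (-l, a) = 0 := by rw [hΦ, hl, map_neg]; simp [f]
      have : (⟨⟨(-l, a), by show Φ (-l, a) ∈ T; rw [e]; exact T.zero_mem⟩, e⟩ :
        LinearMap.ker (Φ.domRestrict K')) ≠ 0 := by
        intro hh
        have := congrArg (fun z => (z.1.1 : (Fin 5 → Fin 5 → ℂ) × (Fin 5 → ℂ)).2) hh
        exact ha this
      have : Nontrivial (LinearMap.ker (Φ.domRestrict K')) := ⟨_, _, this⟩
      exact (Module.finrank_pos_iff (R := ℂ)).2 this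
    rw [r2] at r1
    omega
  let Θ := σ.toLinearMap ∘ₗ Φ
  have hΘ : Module.finrank ℂ (LinearMap.range Θ) ≤ 14 := by
    have r1 := Θ.finrank_range_add_finrank_ker
    have r2 : K' ≤ LinearMap.ker Θ := by
      intro z hz
      obtain ⟨B, hB⟩ := hz
      show σ (Φ z) = 0
      rw [← hB]
      simp [hσa]
    have r3 := Submodule.finrank_mono r2
    have r4 : Module.finrank ℂ ((Fin 5 → Fin 5 → ℂ) × (Fin 5 → ℂ)) = 30 := by
      simp [Module.finrank_pi_fintype]
    omega
  have hΞ : LinearMap.range (psiF w) ≤ LinearMap.range Θ := by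
    rintro _ ⟨m, rfl⟩
    refine ⟨(fun i => ∑ k, N k i • (j.insertNth (α := fun _ => ℂ) 0 (m k) : Fin 5 → ℂ), 0), ?_⟩
    show σ (Φ _) = _
    rw [hΦ, psiF_apply, psiF_apply]
    simp only [map_zero, zero_mul, add_zero, map_sum, map_mul, map_smul, hlift, w, Finset.mul_sum,
      Finset.sum_mul]
    rw [Finset.sum_comm]
    refine Finset.sum_congr rfl fun k _ => Finset.sum_congr rfl fun i _ => ?_
    rw [smul_eq_C_mul]
    ring
  have hker : 2 ≤ Module.finrank ℂ (LinearMap.ker (psiF w)) := by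
    have r1 := (psiF w).finrank_range_add_finrank_ker
    have r2 := Submodule.finrank_mono hΞ
    have r3 : Module.finrank ℂ (Fin 4 → Fin 4 → ℂ) = 16 := by
      simp [Module.finrank_pi_fintype]
    omega
  have := syz_dim (fun k x => ∑ i, N k i * eval (M.mulVec x) (f i))
    (fun k => IsQ.sum_smul (fun i => (hfQ i).comp_mulVec M) _) hN (LinearMap.ker (psiF w)) (by
      intro m hm x
      have e : psiF w m = 0 := hm
      have := congrArg (eval x) e
      rw [psiF_apply] at this
      simpa [eval_linF, hw] using this)
  omega

theorem exists_inj (F : MvPolynomial (Fin 5) ℂ) (hF : F.IsHomogeneous 3)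
    (hs : ∀ x : Fin 5 → ℂ, (∀ i, eval x (pderiv i F) = 0) → x = 0) :
    ∃ B₀, ∀ a, (∃ l, linF 5 a * quadF 5 B₀ = psiF (fun i => pderiv i F) l) → a = 0 := by
  let J := LinearMap.range (psiF (fun i => pderiv i F))
  let μ : (Fin 5 → Fin 5 → ℂ) →ₗ[ℂ] (Fin 5 → ℂ) →ₗ[ℂ] (MvPolynomial (Fin 5) ℂ ⧸ J) :=
    LinearMap.mk₂ ℂ (fun B a => J.mkQ (linF 5 a * quadF 5 B))
      (by intro B B' a; rw [map_add, mul_add, map_add])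
      (by intro c B a; rw [map_smul, mul_smul_comm, map_smul])
      (by intro B a a'; rw [map_add, add_mul, map_add])
      (by intro c B a; rw [map_smul, smul_mul_assoc, map_smul])
  have hμ : ∀ B a, μ B a = J.mkQ (linF 5 a * quadF 5 B) := fun B a => rfl
  by_contra hc
  push Not at hc
  obtain ⟨B, a, ha, h1, h2⟩ := tangent μ (by
    intro B hinj
    obtain ⟨a, ⟨l, hl⟩, ha⟩ := hc B
    apply ha
    apply hinj
    rw [map_zero, hμ, hl]
    simp [J])
  refine count F hF hs (quadF 5 B) a ha ?_ ?_
  · rw [hμ] at h1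
    obtain ⟨l, hl⟩ : _ ∈ J := by simpa using h1
    exact ⟨l, hl.symm⟩
  · intro B'
    obtain ⟨m, hm⟩ := h2 B'
    rw [hμ, hμ, ← sub_eq_zero, ← map_sub] at hm
    obtain ⟨l, hl⟩ : _ ∈ J := by simpa only [Submodule.mkQ_apply, Submodule.Quotient.mk_eq_zero] using hm
    exact ⟨l, m, by rw [hl]; ring⟩

section
open MeasureTheory

theorem homog_one_eq {n : ℕ} {p : MvPolynomial (Fin n) ℂ} (hp : p.IsHomogeneous 1) :
    ∃ a, p = linF n a := by
  have h2 : ∀ j, (pderiv j p).IsHomogeneous 0 := fun j => hp.pderiv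
  have h3 : ∀ j, pderiv j p = C (coeff 0 (pderiv j p)) := fun j => by
    rw [← totalDegree_eq_zero_iff_eq_C]
    exact Nat.le_zero.1 (h2 j).totalDegree_le
  refine ⟨fun j => coeff 0 (pderiv j p), ?_⟩
  have e := hp.sum_X_mul_pderiv
  rw [one_smul] at e
  rw [linF_apply]
  simp only [← h3]
  rw [← e]
  exact Finset.sum_congr rfl fun i _ => by rw [e, mul_comm]

theorem homog_comp_mul {n : ℕ} (c f : MvPolynomial (Fin n) ℂ) (hf : f.IsHomogeneous 2) :
    homogeneousComponent 3 (c * f) = homogeneousComponent 1 c * f := by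
  have h : ∀ m, homogeneousComponent 3 (homogeneousComponent m c * f) =
      if m = 1 then homogeneousComponent 1 c * f else 0 := by
    intro m
    rw [homogeneousComponent_of_mem (n := m + 2)
      ((mem_homogeneousSubmodule _ _).2 ((homogeneousComponent_isHomogeneous m c).mul hf))]
    by_cases hm : m = 1
    · simp [hm]
    · rw [if_neg (by omega), if_neg hm]
  conv_lhs => rw [← sum_homogeneousComponent c, Finset.sum_mul, map_sum]
  simp only [h]
  rw [Finset.sum_ite_eq']
  split_ifs with hh
  · rfl
  · rw [homogeneousComponent_eq_zero]
    · simp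
    · simp at hh; omega

theorem ideal_deg_three (f : Fin 5 → MvPolynomial (Fin 5) ℂ) (hf : ∀ i, (f i).IsHomogeneous 2)
    (b : MvPolynomial (Fin 5) ℂ) (hb : b ∈ Ideal.span (Set.range f)) (hb3 : b.IsHomogeneous 3) :
    ∃ l, b = psiF f l := by
  rw [Ideal.mem_span_range_iff_exists_fun] at hb
  obtain ⟨c, hc⟩ := hb
  choose l hl using fun i => homog_one_eq (homogeneousComponent_isHomogeneous 1 (c i))
  refine ⟨l, ?_⟩
  rw [psiF_apply, ← homogeneousComponent_eq_self hb3, ← hc, map_sum]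
  exact Finset.sum_congr rfl fun i _ => by rw [homog_comp_mul _ _ (hf i), hl]

theorem exists_open_inj (F : MvPolynomial (Fin 5) ℂ) (hF : F.IsHomogeneous 3)
    (hs : ∀ x : Fin 5 → ℂ, (∀ i, eval x (pderiv i F) = 0) → x = 0) :
    ∃ G : Set (Fin 5 → Fin 5 → ℂ), IsOpen G ∧ G.Nonempty ∧ ∀ B ∈ G, ∀ a,
      (∃ l, linF 5 a * quadF 5 B = psiF (fun i => pderiv i F) l) → a = 0 := by
  obtain ⟨B₀, hB₀⟩ := exists_inj F hF hs
  let J := LinearMap.range (psiF (fun i => pderiv i F))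
  let μ : (Fin 5 → Fin 5 → ℂ) →ₗ[ℂ] (Fin 5 → ℂ) →ₗ[ℂ] (MvPolynomial (Fin 5) ℂ ⧸ J) :=
    LinearMap.mk₂ ℂ (fun B a => J.mkQ (linF 5 a * quadF 5 B))
      (by intro B B' a; rw [map_add, mul_add, map_add])
      (by intro c B a; rw [map_smul, mul_smul_comm, map_smul])
      (by intro B a a'; rw [map_add, add_mul, map_add])
      (by intro c B a; rw [map_smul, smul_mul_assoc, map_smul])
  have hμ : ∀ B a, μ B a = J.mkQ (linF 5 a * quadF 5 B) := fun B a => rfl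
  have hμ0 : ∀ B a, μ B a = 0 ↔ ∃ l, linF 5 a * quadF 5 B = psiF (fun i => pderiv i F) l := by
    intro B a
    rw [hμ, Submodule.mkQ_apply, Submodule.Quotient.mk_eq_zero]
    constructor
    · rintro ⟨l, hl⟩; exact ⟨l, hl.symm⟩
    · rintro ⟨l, hl⟩; exact ⟨l, hl.symm⟩
  have hk : LinearMap.ker (μ B₀) = ⊥ := by
    rw [Submodule.eq_bot_iff]
    intro a ha
    exact hB₀ a ((hμ0 _ _).1 ha)
  let b := Pi.basisFun ℂ (Fin 5)
  have hli := b.linearIndependent.map' (μ B₀) hk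
  obtain ⟨φ, hφ⟩ := exists_dual hli
  refine ⟨{B | (Matrix.of fun i => φ (μ B (b i))).det ≠ 0}, ?_, ⟨B₀, ?_⟩, ?_⟩
  · apply IsOpen.preimage _ isOpen_ne
    apply Continuous.matrix_det
    apply continuous_pi
    intro i
    exact (φ ∘ₗ (μ.flip (b i))).continuous_of_finiteDimensional
  · show (Matrix.of fun i => φ (μ B₀ (b i))).det ≠ 0
    have : (Matrix.of fun i => φ (μ B₀ (b i))) = 1 := by
      ext i j
      have := hφ i
      simp only [Function.comp_apply] at this
      rw [Matrix.of_apply, this]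
      simp [Matrix.one_apply, Pi.single_apply, eq_comm]
    rw [this]; simp
  · intro B hB a ha
    rw [← hμ0] at ha
    have hB' : LinearIndependent ℂ (fun i => μ B (b i)) := linInd_of_det φ hB
    rw [Fintype.linearIndependent_iff] at hB'
    funext i
    apply hB' a
    rw [← ha]
    conv_rhs => rw [← b.sum_repr a, map_sum]
    simp [b]

theorem homog_scale {n d : ℕ} {p : MvPolynomial (Fin n) ℂ} (hp : p.IsHomogeneous d) (c : ℂ)
    (x : Fin n → ℂ) : eval (c • x) p = c ^ d * eval x p := by
  rw [eval_eq, eval_eq, Finset.mul_sum]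
  refine Finset.sum_congr rfl fun m hm => ?_
  have hd := hp (mem_support_iff.1 hm)
  simp only [Pi.smul_apply, smul_eq_mul, mul_pow, Finset.prod_mul_distrib, Finset.prod_pow_eq_pow_sum]
  have : ∑ i ∈ m.support, m i = d := by
    rw [← hd, Finsupp.weight_apply]
    simp [Finsupp.sum]
  rw [this]; ring

theorem null_zero (F : MvPolynomial (Fin 5) ℂ) (hF : F.IsHomogeneous 3) (hF0 : F ≠ 0) (j : Fin 5) :
    (Measure.addHaar : Measure (Fin 5 → Fin 5 → ℂ)) {c | eval (c j) F = 0} = 0 := by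
  obtain ⟨u, hu⟩ : ∃ u, eval u F ≠ 0 := by
    by_contra hc
    push Not at hc
    exact hF0 (MvPolynomial.funext fun x => by rw [hc, map_zero])
  let L : ℂ →ₗ[ℝ] (Fin 5 → Fin 5 → ℂ) :=
    { toFun := fun t => Pi.single j (t • u)
      map_add' := by intro s t; rw [add_smul, Pi.single_add]
      map_smul' := by intro r t; rw [smul_assoc, Pi.single_smul]; rfl }
  have hcont : Continuous (fun c : Fin 5 → Fin 5 → ℂ => eval (c j) F) :=
    (MvPolynomial.continuous_eval F).comp (continuous_apply j)
  have key := ae_mem_of_ae_add_linearMap_mem L (volume : Measure ℂ)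
    (Measure.addHaar : Measure (Fin 5 → Fin 5 → ℂ)) (s := {c | eval (c j) F ≠ 0})
    ((isOpen_ne.preimage hcont).measurableSet) (by
      intro y
      let G : Polynomial ℂ := aeval (fun i => Polynomial.C (u i) + Polynomial.C (y j i) * Polynomial.X) F
      have hG : ∀ s, G.eval s = eval (u + s • y j) F := by
        intro s
        have : (Polynomial.evalRingHom s).comp (aeval (R := ℂ) (fun i => Polynomial.C (u i) + Polynomial.C (y j i) * Polynomial.X)).toRingHom = eval (u + s • y j) := by
          apply MvPolynomial.ringHom_ext
          · intro r; simp
          · intro i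
            simp; ring
        exact RingHom.congr_fun this F
      have hG0 : G ≠ 0 := by
        intro h
        apply hu
        have := hG 0
        simpa [h] using this.symm
      have hfin : ((fun t => t⁻¹) '' (insert 0 {t | G.IsRoot t})).Finite :=
        ((Polynomial.finite_setOf_isRoot hG0).insert 0).image _
      rw [ae_iff]
      refine measure_mono_null ?_ (hfin.countable.measure_zero volume)
      intro t ht
      have ht' : eval ((y + L t) j) F = 0 := not_not.1 ht
      have e : (y + L t) j = y j + t • u := by simp [L]
      rw [e] at ht'
      refine ⟨t⁻¹, ?_, inv_inv t⟩
      by_cases h0 : t = 0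
      · left; simp [h0]
      · right
        show G.eval _ = 0
        rw [hG]
        have : u + t⁻¹ • y j = t⁻¹ • (y j + t • u) := by
          rw [smul_add, smul_smul, inv_mul_cancel₀ h0, one_smul, add_comm]
        rw [this, homog_scale hF, ht', mul_zero])
  rw [ae_iff] at key
  simpa using key

theorem diff_eval {n : ℕ} (p : MvPolynomial (Fin n) ℂ) : Differentiable ℝ (fun x : Fin n → ℂ => eval x p) := by
  induction p using MvPolynomial.induction_on with
  | C a => simp
  | add p q hp hq =>
    simp only [map_add]
    exact hp.add hq
  | mul_X p i hp =>
    simp only [map_mul, eval_X]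
    exact hp.mul (differentiable_apply i)

/-- auxiliary row entries -/
noncomputable def rowA (F : MvPolynomial (Fin 5) ℂ) (j : Fin 5) (lam : ℂ) (c : Fin 5 → Fin 5 → ℂ) (i : Fin 5) : ℂ :=
  (lam * eval (c j) (pderiv i F) - ∑ k ∈ Finset.univ.erase j, (c i k + c k i) * c j k) / c j j - c i j

/-- parametrisation of the bad set -/
noncomputable def badMap (F : MvPolynomial (Fin 5) ℂ) (j : Fin 5) (lam : ℂ) (c : Fin 5 → Fin 5 → ℂ) :
    Fin 5 → Fin 5 → ℂ := fun i k =>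
  if i = j then
    (if k = j then (lam * eval (c j) (pderiv j F)
      - ∑ k ∈ Finset.univ.erase j, (rowA F j lam c k + c k j) * c j k) / c j j / 2
    else rowA F j lam c k)
  else c i k

theorem badMap_eq (F : MvPolynomial (Fin 5) ℂ) (j : Fin 5) (lam : ℂ) (B : Fin 5 → Fin 5 → ℂ) (p : Fin 5 → ℂ)
    (hp : p j ≠ 0) (h : ∀ i, ∑ k, (B i k + B k i) * p k = lam * eval p (pderiv i F)) :
    badMap F j lam (Function.update B j p) = B := by
  have h' : ∀ i, (B i j + B j i) * p j + ∑ k ∈ Finset.univ.erase j, (B i k + B k i) * p k =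
      lam * eval p (pderiv i F) := by
    intro i
    rw [← h i, Finset.add_sum_erase _ (fun k => (B i k + B k i) * p k) (Finset.mem_univ j)]
  have hr : ∀ i, i ≠ j → rowA F j lam (Function.update B j p) i = B j i := by
    intro i hi
    unfold rowA
    rw [Function.update_self, Function.update_of_ne hi, ← h' i]
    have e : ∑ k ∈ Finset.univ.erase j, (B i k + Function.update B j p k i) * p k =
        ∑ k ∈ Finset.univ.erase j, (B i k + B k i) * p k :=
      Finset.sum_congr rfl fun k hk => by rw [Function.update_of_ne (Finset.ne_of_mem_erase hk)]
    rw [e]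
    field_simp
    ring
  funext i k
  unfold badMap
  split_ifs with hi hk
  · subst hi
    subst hk
    rw [Function.update_self, ← h' k]
    have e : ∑ i ∈ Finset.univ.erase k,
        (rowA F k lam (Function.update B k p) i + Function.update B k p i k) * p i =
        ∑ i ∈ Finset.univ.erase k, (B k i + B i k) * p i :=
      Finset.sum_congr rfl fun i hi => by
        rw [Function.update_of_ne (Finset.ne_of_mem_erase hi), hr i (Finset.ne_of_mem_erase hi)]
    rw [e]
    field_simp
    ring
  · rw [hr k hk, hi]
  · rw [Function.update_of_ne hi]

theorem badMap_diff (F : MvPolynomial (Fin 5) ℂ) (j : Fin 5) (lam : ℂ) (s : Set (Fin 5 → Fin 5 → ℂ))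
    (hs : ∀ c ∈ s, c j j ≠ 0) : DifferentiableOn ℝ (badMap F j lam) s := by
  have h1 : ∀ i k, Differentiable ℝ (fun c : Fin 5 → Fin 5 → ℂ => c i k) := by
    intro i k; fun_prop
  have h2 : ∀ i, Differentiable ℝ (fun c : Fin 5 → Fin 5 → ℂ => eval (c j) (pderiv i F)) := by
    intro i
    exact (diff_eval (pderiv i F)).comp (differentiable_apply j)
  have hdiv : ∀ f : (Fin 5 → Fin 5 → ℂ) → ℂ, DifferentiableOn ℝ f s →
      DifferentiableOn ℝ (fun c => f c / c j j) s := by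
    intro f hf
    simp only [div_eq_mul_inv]
    exact hf.mul ((h1 j j).differentiableOn.inv hs)
  have h3 : ∀ i, DifferentiableOn ℝ (fun c => rowA F j lam c i) s := by
    intro i
    unfold rowA
    refine DifferentiableOn.sub (hdiv _ ?_) (h1 i j).differentiableOn
    refine DifferentiableOn.sub ((h2 i).differentiableOn.const_mul lam) ?_
    refine DifferentiableOn.fun_sum fun k _ => ?_
    exact (((h1 i k).add (h1 k i)).mul (h1 j k)).differentiableOn
  rw [differentiableOn_pi]
  intro i
  rw [differentiableOn_pi]
  intro k
  unfold badMap
  split_ifs with hi hk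
  · simp only [div_eq_mul_inv _ (2 : ℂ)]
    refine DifferentiableOn.mul_const (hdiv _ ?_) _
    refine DifferentiableOn.sub ((h2 j).differentiableOn.const_mul lam) ?_
    refine DifferentiableOn.fun_sum fun k _ => ?_
    exact ((h3 k).add (h1 k j).differentiableOn).mul (h1 j k).differentiableOn
  · exact h3 k
  · exact (h1 i k).differentiableOn

theorem eval_pderiv_quadF (B : Fin 5 → Fin 5 → ℂ) (p : Fin 5 → ℂ) (i : Fin 5) :
    eval p (pderiv i (quadF 5 B)) = ∑ k, (B i k + B k i) * p k := by
  simp only [quadF_apply, map_sum, Derivation.leibniz, pderiv_C, pderiv_X, smul_eq_mul, mul_zero, add_zero,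
    map_add, map_mul, eval_C, eval_X]
  simp only [Pi.single_apply, apply_ite (eval p), map_one, map_zero, mul_ite, mul_one, mul_zero, mul_add,
    Finset.sum_add_distrib, Finset.sum_ite_eq, Finset.sum_ite_eq', Finset.mem_univ, if_true, add_mul]
  simp only [Finset.sum_comm (f := fun x y => if i = x then _ else _), eq_comm]
  simp [add_comm]

theorem bad_null (F : MvPolynomial (Fin 5) ℂ) (hF : F.IsHomogeneous 3)
    (hs : ∀ x : Fin 5 → ℂ, (∀ i, eval x (pderiv i F) = 0) → x = 0) :
    (Measure.addHaar : Measure (Fin 5 → Fin 5 → ℂ)) {B | ∃ p : Fin 5 → ℂ, p ≠ 0 ∧ eval p F = 0 ∧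
      ¬ LinearIndependent ℂ ![fun i => eval p (pderiv i F), fun i => eval p (pderiv i (quadF 5 B))]} = 0 := by
  have hF0 : F ≠ 0 := by
    rintro rfl
    have := hs 1 (by simp)
    have := congrFun this 0
    simp at this
  have hn : ∀ (j : Fin 5) (e : Bool), (Measure.addHaar : Measure (Fin 5 → Fin 5 → ℂ))
      (badMap F j (if e then 1 else 0) '' {c | eval (c j) F = 0 ∧ c j j ≠ 0}) = 0 := by
    intro j e
    apply addHaar_image_eq_zero_of_differentiableOn_of_addHaar_eq_zero
    · exact badMap_diff F j _ _ (fun c hc => hc.2)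
    · exact measure_mono_null (fun c hc => hc.1) (null_zero F hF hF0 j)
  have hU : (Measure.addHaar : Measure (Fin 5 → Fin 5 → ℂ)) (⋃ j : Fin 5, ⋃ e : Bool,
      badMap F j (if e then 1 else 0) '' {c | eval (c j) F = 0 ∧ c j j ≠ 0}) = 0 :=
    measure_iUnion_null fun j => measure_iUnion_null fun e => hn j e
  refine measure_mono_null ?_ hU
  rintro B ⟨p, hp, hpF, hli⟩
  suffices ∃ (e : Bool) (p : Fin 5 → ℂ), p ≠ 0 ∧ eval p F = 0 ∧
      ∀ i, ∑ k, (B i k + B k i) * p k = (if e then 1 else 0) * eval p (pderiv i F) by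
    obtain ⟨e, p, hp, hpF, hh⟩ := this
    obtain ⟨j, hj⟩ : ∃ j, p j ≠ 0 := by
      by_contra hc
      push Not at hc
      exact hp (_root_.funext hc)
    refine Set.mem_iUnion.2 ⟨j, Set.mem_iUnion.2 ⟨e, ⟨Function.update B j p, ?_, badMap_eq F j _ B p hj hh⟩⟩⟩
    refine ⟨?_, ?_⟩
    · rw [Function.update_self]; exact hpF
    · rw [Function.update_self]; exact hj
  rw [LinearIndependent.pair_iff] at hli
  push Not at hli
  obtain ⟨s, t, hst, hne⟩ := hli
  have hst' : ∀ i, s * eval p (pderiv i F) + t * ∑ k, (B i k + B k i) * p k = 0 := by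
    intro i
    have := congrFun hst i
    simpa [eval_pderiv_quadF] using this
  have ht : t ≠ 0 := by
    rintro rfl
    have hs0 : s ≠ 0 := fun h => hne h rfl
    apply hp
    apply hs
    intro i
    have := hst' i
    simpa [hs0] using this
  have h1 : ∀ i, ∑ k, (B i k + B k i) * p k = (-s / t) * eval p (pderiv i F) := by
    intro i
    have := hst' i
    field_simp
    linear_combination this
  by_cases hs0 : s = 0
  · refine ⟨false, p, hp, hpF, fun i => ?_⟩
    rw [h1, hs0]; simp
  · set l := -s / t with hl
    have hl0 : l ≠ 0 := div_ne_zero (neg_ne_zero.2 hs0) ht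
    refine ⟨true, l • p, smul_ne_zero hl0 hp, ?_, fun i => ?_⟩
    · rw [homog_scale hF, hpF, mul_zero]
    · have hd : (pderiv i F).IsHomogeneous 2 := hF.pderiv
      rw [homog_scale hd, if_pos rfl, one_mul, pow_two, mul_assoc, ← h1, Finset.mul_sum]
      exact Finset.sum_congr rfl fun k _ => by simp only [Pi.smul_apply, smul_eq_mul]; ring

theorem quadF_homog (B : Fin 5 → Fin 5 → ℂ) : (quadF 5 B).IsHomogeneous 2 := by
  rw [quadF_apply]
  refine IsHomogeneous.sum _ _ _ fun i _ => IsHomogeneous.sum _ _ _ fun j _ => ?_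
  have := (isHomogeneous_C (Fin 5) (B i j)).mul ((isHomogeneous_X ℂ i).mul (isHomogeneous_X ℂ j))
  simpa using this

theorem main_aux (F : MvPolynomial (Fin 5) ℂ) (hF : F.IsHomogeneous 3)
    (hs : ∀ x : Fin 5 → ℂ, (∀ i, eval x (pderiv i F) = 0) → x = 0) :
    ∃ B : Fin 5 → Fin 5 → ℂ, (∀ p : Fin 5 → ℂ, p ≠ 0 → eval p F = 0 →
      LinearIndependent ℂ ![fun i => eval p (pderiv i F), fun i => eval p (pderiv i (quadF 5 B))]) ∧
      ∀ a, (∃ l, linF 5 a * quadF 5 B = psiF (fun i => pderiv i F) l) → a = 0 := by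
  obtain ⟨G, hG, hGn, hGi⟩ := exists_open_inj F hF hs
  have hpos : (Measure.addHaar : Measure (Fin 5 → Fin 5 → ℂ)) G ≠ 0 := hG.measure_ne_zero _ hGn
  by_contra hc
  push Not at hc
  apply hpos
  refine measure_mono_null ?_ (bad_null F hF hs)
  intro B hB
  by_contra hB'
  obtain ⟨a, ha, ha0⟩ := hc B (by
    intro p hp hpF
    by_contra hl
    exact hB' ⟨p, hp, hpF, hl⟩)
  exact ha0 (hGi B hB a ha)

end

/-- For every smooth cubic `F` there is a quadric `Q` with `(F,Q)` a smooth complete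
intersection and `(J_{F,3}:Q) = 0`. -/
theorem exists_Q_colon_three_zero :
    ∀ F ∈ homogeneousSubmodule (Fin 5) ℂ 3, SmoothForm F →
      ∃ Q ∈ homogeneousSubmodule (Fin 5) ℂ 2, SmoothCI F Q ∧
        ∀ a ∈ homogeneousSubmodule (Fin 5) ℂ 1, a * Q ∈ Jpart F 3 → a = 0 := by
  intro F hF hs
  have hF' : F.IsHomogeneous 3 := hF
  obtain ⟨B, hB1, hB2⟩ := main_aux F hF' hs
  refine ⟨quadF 5 B, quadF_homog B, fun p hp hpF _ => hB1 p hp hpF, fun a ha haJ => ?_⟩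
  obtain ⟨a', rfl⟩ := homog_one_eq (p := a) ha
  obtain ⟨l, hl⟩ := ideal_deg_three (fun i => pderiv i F) (fun i => hF'.pderiv) _ haJ.1 haJ.2
  rw [hB2 a' ⟨l, hl⟩, map_zero]
end
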